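/- Let X be a Nash subset of an open set Ω ⊆ C^n. Then every irreducible analytic component of X is an irreducible Nash subset of Ω. Moreover, if X is irreducible then there exists an algebraic subset Y of C^n such that X is an irreducible analytic component of Y ∩ Ω. -/

import Mathlib

open Filter Topology

/-- `X` is an analytic subset of `Ω`: near every point of `Ω` it is the common zero set
of finitely many holomorphic functions. -/
def IsAnalyticIn {E : Type} [NormedAddCommGroup E] [NormedSpace ℂ E] (Ω X : Set E) : Prop :=
  X ⊆ Ω ∧ ∀ z ∈ Ω, ∃ U : Set E, IsOpen U ∧ z ∈ U ∧ ∃ (N : ℕ) (g : Fin N → E → ℂ),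
    (∀ i, DifferentiableOn ℂ (g i) U) ∧ X ∩ U = {x ∈ U | ∀ i, g i x = 0}

/-- `x` is a regular point of `X` of (complex) dimension `d`: near `x`, after a
`ℂ`-linear change of coordinates, `X` is the graph of a holomorphic map defined on an
open subset of `ℂ^d`. -/
def IsRegPtOfDim {E : Type} [NormedAddCommGroup E] [NormedSpace ℂ E]
    (d : ℕ) (X : Set E) (x : E) : Prop :=
  ∃ U : Set E, IsOpen U ∧ x ∈ U ∧
    ∃ (e : ℕ) (L : E ≃L[ℂ] ((Fin d → ℂ) × (Fin e → ℂ)))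
      (Ω : Set (Fin d → ℂ)) (g : (Fin d → ℂ) → (Fin e → ℂ)),
      IsOpen Ω ∧ DifferentiableOn ℂ g Ω ∧
      L '' (X ∩ U) = {p : (Fin d → ℂ) × (Fin e → ℂ) | p.1 ∈ Ω ∧ p.2 = g p.1}

/-- `X` has pure dimension `d`: regular points (necessarily of dimension `d`) are dense in `X`. -/
def PureDim {E : Type} [NormedAddCommGroup E] [NormedSpace ℂ E] (X : Set E) (d : ℕ) : Prop :=
  (∀ x ∈ X, x ∈ closure {y | y ∈ X ∧ IsRegPtOfDim d X y}) ∧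
  (∀ e : ℕ, ∀ x ∈ X, IsRegPtOfDim e X x → e = d)

/-- `d` is the dimension of `X`: the maximum of the dimensions at regular points. -/
def SetDimIs {E : Type} [NormedAddCommGroup E] [NormedSpace ℂ E] (X : Set E) (d : ℕ) : Prop :=
  (∃ x ∈ X, IsRegPtOfDim d X x) ∧ ∀ e : ℕ, ∀ x ∈ X, IsRegPtOfDim e X x → e ≤ d

/-- The natural projection restricted to `Y` is proper over `U`. -/
def ProperProjOn {A B : Type} [TopologicalSpace A] [TopologicalSpace B]
    (U : Set A) (Y : Set (A × B)) : Prop :=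
  ∀ K ⊆ U, IsCompact K → IsCompact {p | p ∈ Y ∧ p.1 ∈ K}

/-- The projection `π|_Y` is regular (an analytic isomorphism) at `p`:
near `p`, `Y` is the graph of a holomorphic map. -/
def ProjRegularAt {A B : Type} [NormedAddCommGroup A] [NormedSpace ℂ A]
    [NormedAddCommGroup B] [NormedSpace ℂ B] (Y : Set (A × B)) (p : A × B) : Prop :=
  ∃ W : Set A, IsOpen W ∧ p.1 ∈ W ∧ ∃ g : A → B, DifferentiableOn ℂ g W ∧
    ∃ V : Set (A × B), IsOpen V ∧ p ∈ V ∧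
      Y ∩ V = {q : A × B | q.1 ∈ W ∧ q.2 = g q.1} ∩ V

/-- The set `S(Y, π)` of singular points of the projection `π|_Y`. -/
def SingProj {A B : Type} [NormedAddCommGroup A] [NormedSpace ℂ A]
    [NormedAddCommGroup B] [NormedSpace ℂ B] (Y : Set (A × B)) : Set (A × B) :=
  {p | p ∈ Y ∧ ¬ ProjRegularAt Y p}

/-- `X` is irreducible as an analytic subset of `Ω`. -/
def IrredAnalyticIn {E : Type} [NormedAddCommGroup E] [NormedSpace ℂ E] (Ω X : Set E) : Prop :=
  IsAnalyticIn Ω X ∧ X.Nonempty ∧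
    ∀ X₁ X₂ : Set E, IsAnalyticIn Ω X₁ → IsAnalyticIn Ω X₂ → X = X₁ ∪ X₂ → X = X₁ ∨ X = X₂

/-- `C` is an irreducible analytic component of `X` (inside `Ω`). -/
def IsIrredComp {E : Type} [NormedAddCommGroup E] [NormedSpace ℂ E] (Ω X C : Set E) : Prop :=
  IrredAnalyticIn Ω C ∧ C ⊆ X ∧
    ∀ C' : Set E, IrredAnalyticIn Ω C' → C ⊆ C' → C' ⊆ X → C' = C

/-- `Z` has generic fiber cardinality `s` over `E`: outside a proper analytic subset of `E`
every fiber of the projection has exactly `s` points. -/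
def GenFiberCard {A B : Type} [NormedAddCommGroup A] [NormedSpace ℂ A]
    (E : Set A) (Z : Set (A × B)) (s : ℕ) : Prop :=
  ∃ T : Set A, IsAnalyticIn E T ∧ T ≠ E ∧ ∀ x ∈ E \ T, Set.ncard {v : B | (x, v) ∈ Z} = s

/-- An algebraic subset of `ℂ^N`. -/
def IsAlgSet (N : ℕ) (V : Set (Fin N → ℂ)) : Prop :=
  ∃ (q : ℕ) (ps : Fin q → MvPolynomial (Fin N) ℂ),
    V = {y | ∀ i, MvPolynomial.eval y (ps i) = 0}

/-- A Nash function on an open set `U ⊆ ℂ^N`. -/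
def NashFn (N : ℕ) (U : Set (Fin N → ℂ)) (f : (Fin N → ℂ) → ℂ) : Prop :=
  DifferentiableOn ℂ f U ∧ ∀ x₀ ∈ U, ∃ V : Set (Fin N → ℂ), IsOpen V ∧ x₀ ∈ V ∧
    ∃ P : Polynomial (MvPolynomial (Fin N) ℂ), P ≠ 0 ∧
      ∀ x ∈ V ∩ U, Polynomial.eval₂ (MvPolynomial.eval x) (f x) P = 0

/-- `X` is a Nash subset of `Ω ⊆ ℂ^N`. -/
def IsNashIn (N : ℕ) (Ω X : Set (Fin N → ℂ)) : Prop :=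
  X ⊆ Ω ∧ ∀ z ∈ Ω, ∃ U : Set (Fin N → ℂ), IsOpen U ∧ z ∈ U ∧
    ∃ (q : ℕ) (g : Fin q → (Fin N → ℂ) → ℂ),
      (∀ i, NashFn N U (g i)) ∧ X ∩ U = {x ∈ U | ∀ i, g i x = 0}

section Holomorphic

variable {E : Type} [NormedAddCommGroup E] [NormedSpace ℂ E]

/-- Identity theorem on convex open sets. -/
lemma eq_zero_of_eventually_eq_zero {B : Set E} (hB : IsOpen B) (hc : Convex ℝ B) {f : E → ℂ}
    (hf : DifferentiableOn ℂ f B) {b : E} (hb : b ∈ B) (h : ∀ᶠ x in 𝓝 b, f x = 0) :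
    ∀ x ∈ B, f x = 0 := by
  intro x hx
  let l : ℂ → E := fun τ => b + τ • (x - b)
  have hl : Differentiable ℂ l := by fun_prop
  have hT : IsOpen (l ⁻¹' B) := hB.preimage hl.continuous
  have hTc : Convex ℝ (l ⁻¹' B) := by
    intro p hp q hq s t hs ht hst
    have : l (s • p + t • q) = s • l p + t • l q := by
      simp only [l, smul_add, add_smul, smul_assoc]
      have : b = s • b + t • b := by rw [← add_smul, hst, one_smul]
      nth_rewrite 1 [this]
      abel
    simp only [Set.mem_preimage, this]
    exact hc hp hq hs ht hst
  have hfa : AnalyticOnNhd ℂ (f ∘ l) (l ⁻¹' B) := by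
    refine DifferentiableOn.analyticOnNhd ?_ hT
    exact hf.comp hl.differentiableOn (fun _ h => h)
  have h0 : l 0 = b := by simp [l]
  have := hfa.eqOn_zero_of_preconnected_of_eventuallyEq_zero hTc.isPreconnected
    (z₀ := 0) (by simpa [h0] using hb) (by
      have : Tendsto l (𝓝 0) (𝓝 b) := by
        have := hl.continuous.tendsto 0
        rwa [h0] at this
      exact this.eventually h)
  have h1 : l 1 = x := by simp [l]
  have h2 := this (x := 1) (by simpa [h1] using hx)
  simpa [h1] using h2

/-- The nonvanishing locus of a nonzero entire function is dense. -/
lemma dense_ne_zero {δ : E → ℂ} (hδ : Differentiable ℂ δ) (h0 : ∃ x, δ x ≠ 0) :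
    Dense {x | δ x ≠ 0} := by
  intro x
  by_contra hx
  obtain ⟨y, hy⟩ := h0
  refine hy (eq_zero_of_eventually_eq_zero (b := x) isOpen_univ convex_univ
    hδ.differentiableOn trivial ?_ y trivial)
  rw [mem_closure_iff_frequently, not_frequently] at hx
  filter_upwards [hx] with z hz
  simpa using hz

/-- A bounded function of one variable, holomorphic away from isolated points, extends. -/
lemma exists_extension_one_var {s : Set ℂ} (hs : IsOpen s) {f δ : ℂ → ℂ}
    (hδ : ∀ c ∈ s, ∀ᶠ z in 𝓝[≠] c, δ z ≠ 0)
    (hf : ∀ z ∈ s, δ z ≠ 0 → DifferentiableAt ℂ f z) {C : ℝ}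
    (hb : ∀ z ∈ s, δ z ≠ 0 → ‖f z‖ ≤ C) :
    ∃ F : ℂ → ℂ, DifferentiableOn ℂ F s ∧ ∀ z ∈ s, δ z ≠ 0 → F z = f z := by
  refine ⟨fun c => limUnder (𝓝[≠] c) f, ?_, ?_⟩
  · intro c hc
    obtain ⟨t, ht, hct, hto⟩ : ∃ t : Set ℂ, (∀ z ∈ t, z ≠ c → z ∈ s ∧ δ z ≠ 0) ∧ c ∈ t ∧
        IsOpen t := by
      have h1 := hδ c hc
      rw [eventually_nhdsWithin_iff] at h1
      obtain ⟨t, ht, hto, hct⟩ := eventually_nhds_iff.1 (h1.and (hs.eventually_mem hc))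
      exact ⟨t, fun z hz hzc => ⟨(ht z hz).2, (ht z hz).1 hzc⟩, hct, hto⟩
    have := Complex.differentiableOn_update_limUnder_of_bddAbove (f := f) (hto.mem_nhds hct)
      (fun z hz => (hf z (ht z hz.1 hz.2).1 (ht z hz.1 hz.2).2).differentiableWithinAt)
      (by
        refine ⟨C, ?_⟩
        rintro _ ⟨z, hz, rfl⟩
        exact hb z (ht z hz.1 hz.2).1 (ht z hz.1 hz.2).2)
    have h2 := (this c hct).differentiableAt (hto.mem_nhds hct)
    refine (h2.congr_of_eventuallyEq ?_).differentiableWithinAt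
    filter_upwards [hto.mem_nhds hct] with z hz
    by_cases hzc : z = c
    · subst hzc; simp
    · rw [Function.update_of_ne hzc]
      have := (hf z (ht z hz hzc).1 (ht z hz hzc).2).continuousAt
      exact (this.tendsto.mono_left nhdsWithin_le_nhds).limUnder_eq
  · intro z hz hz0
    have := (hf z hz hz0).continuousAt
    exact (this.tendsto.mono_left nhdsWithin_le_nhds).limUnder_eq

end Holomorphic

section Riemann

variable {E : Type} [NormedAddCommGroup E] [NormedSpace ℂ E] [FiniteDimensional ℂ E]

open MeasureTheory Metric in
/-- A circle average of translates of a bounded holomorphic function is holomorphic. -/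
lemma differentiableAt_circleAverage {W : Set E} (hW : IsOpen W) {h : E → ℂ} {C s : ℝ} {v z : E}
    (hh : DifferentiableOn ℂ h W) (hb : ∀ x ∈ W, ‖h x‖ ≤ C)
    (hz : ∀ᶠ x in 𝓝 z, ∀ θ, x + circleMap 0 s θ • v ∈ W) :
    DifferentiableAt ℂ (fun x => Real.circleAverage (fun τ => h (x + τ • v)) 0 s) z := by
  obtain ⟨ε, hε, hV⟩ := Metric.eventually_nhds_iff_ball.1 hz
  let _ : MeasurableSpace E := borel E
  have : BorelSpace E := ⟨rfl⟩
  have : ProperSpace E := FiniteDimensional.proper ℂ E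
  have hcont : ∀ x ∈ ball z ε, Continuous fun θ => h (x + circleMap 0 s θ • v) := by
    intro x hx
    refine hh.continuousOn.comp_continuous ?_ (hV x hx)
    have := continuous_circleMap 0 s
    fun_prop
  have key := intervalIntegral.hasFDerivAt_integral_of_dominated_loc_of_lip (𝕜 := ℂ) (μ := volume)
    (a := 0) (b := 2 * Real.pi) (x₀ := z) (s := ball z (ε / 4)) (E := ℂ) (H := E)
    (F := fun x θ => h (x + circleMap 0 s θ • v))
    (F' := fun θ => fderiv ℂ h (z + circleMap 0 s θ • v))
    (bound := fun _ => 2 * C / (ε / 2)) (ball_mem_nhds z (by positivity))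
    (by
      filter_upwards [ball_mem_nhds z hε] with x hx
      exact (hcont x hx).aestronglyMeasurable)
    ((hcont z (mem_ball_self hε)).intervalIntegrable _ _)
    (by
      have h1 : Measurable fun θ => fderiv ℂ h (z + circleMap 0 s θ • v) := by
        refine (measurable_fderiv ℂ h).comp ?_
        have := continuous_circleMap 0 s
        have : Continuous fun θ => z + circleMap 0 s θ • v := by fun_prop
        exact this.measurable
      exact h1.aestronglyMeasurable)
    (by
      refine Eventually.of_forall fun θ _ => ?_
      refine LipschitzOnWith.of_dist_le_mul fun x hx y hy => ?_
      have hyR : ball y (ε / 2) ⊆ ball z ε := by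
        refine ball_subset_ball' ?_
        have := mem_ball.1 hy
        linarith
      have hd : DifferentiableOn ℂ (fun x => h (x + circleMap 0 s θ • v)) (ball y (ε / 2)) := by
        refine hh.comp (by fun_prop) fun x hx => hV x (hyR hx) θ
      have hm : Set.MapsTo (fun x => h (x + circleMap 0 s θ • v)) (ball y (ε / 2))
          (closedBall (h (y + circleMap 0 s θ • v)) (2 * C)) := by
        intro x hx
        rw [mem_closedBall, dist_eq_norm]
        have h1 := hb _ (hV x (hyR hx) θ)
        have h2 := hb _ (hV y (hyR (mem_ball_self (by positivity))) θ)
        have h3 := norm_sub_le (h (x + circleMap 0 s θ • v)) (h (y + circleMap 0 s θ • v))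
        linarith
      refine (Complex.dist_le_div_mul_dist_of_mapsTo_ball hd hm ?_).trans ?_
      · rw [mem_ball] at *
        have := dist_triangle_right x y z
        linarith
      · refine mul_le_mul_of_nonneg_right ?_ dist_nonneg
        rw [Real.coe_nnabs]
        exact le_abs_self _)
    intervalIntegrable_const
    (by
      refine Eventually.of_forall fun θ _ => ?_
      have := (hh.differentiableAt (hW.mem_nhds (hV z (mem_ball_self hε) θ))).hasFDerivAt
      exact this.comp z ((hasFDerivAt_id z).add_const _))
  have := key.2.differentiableAt
  simp only [Real.circleAverage]
  exact this.const_smul _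

/-- Riemann extension: a bounded function, holomorphic off the zero set of a nonzero entire
function, extends holomorphically. -/
lemma exists_extension {U : Set E} (hU : IsOpen U) {δ : E → ℂ} (hδ : Differentiable ℂ δ)
    (h0 : ∃ x, δ x ≠ 0) {h : E → ℂ} (hd : ∀ z ∈ U, δ z ≠ 0 → DifferentiableAt ℂ h z) {C : ℝ}
    (hb : ∀ z ∈ U, δ z ≠ 0 → ‖h z‖ ≤ C) :
    ∃ H : E → ℂ, DifferentiableOn ℂ H U ∧ ∀ z ∈ U, δ z ≠ 0 → H z = h z := by
  have hdense := dense_ne_zero hδ h0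
  have hopen : IsOpen {z | δ z ≠ 0} := isOpen_ne_fun hδ.continuous continuous_const
  have one : ∀ a v : E, δ (a + v) ≠ 0 → ∀ c : ℂ, ∀ᶠ τ in 𝓝[≠] c, δ (a + τ • v) ≠ 0 := by
    intro a v hv c
    have hl : Differentiable ℂ fun τ : ℂ => δ (a + τ • v) := hδ.comp (by fun_prop)
    rcases (hl.analyticAt c).eventually_eq_zero_or_eventually_ne_zero with h | h
    · exfalso
      have := eq_zero_of_eventually_eq_zero isOpen_univ convex_univ hl.differentiableOn
        (Set.mem_univ c) h 1 trivial
      simp only [one_smul] at this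
      exact hv this
    · exact h
  have loc : ∀ z1 ∈ U, ∃ e : E → ℂ, ∀ᶠ z in 𝓝 z1, DifferentiableAt ℂ e z ∧
      (δ z ≠ 0 → e z = h z) := by
    intro z1 hz1
    obtain ⟨v, hv⟩ : ∃ v, δ (z1 + v) ≠ 0 := by
      obtain ⟨x, hx⟩ := h0
      exact ⟨x - z1, by simpa using hx⟩
    have hU0 : ∀ᶠ τ in 𝓝 (0 : ℂ), z1 + τ • v ∈ U := by
      have : Continuous fun τ : ℂ => z1 + τ • v := by fun_prop
      exact this.continuousAt.eventually_mem (by simpa using hU.mem_nhds hz1)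
    obtain ⟨ε, hε, hball⟩ := Metric.eventually_nhds_iff_ball.1
      (hU0.and (eventually_nhdsWithin_iff.1 (one z1 v hv 0)))
    set s := ε / 2 with hs
    have hspos : 0 < s := by positivity
    have hK1 : ∀ᶠ z in 𝓝 z1, ∀ τ ∈ Metric.closedBall (0 : ℂ) s, z + τ • v ∈ U := by
      refine (isCompact_closedBall (0 : ℂ) s).eventually_forall_of_forall_eventually fun τ hτ => ?_
      have : Continuous fun p : E × ℂ => p.1 + p.2 • v := by fun_prop
      refine this.continuousAt.eventually_mem (hU.mem_nhds (hball τ ?_).1)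
      rw [mem_closedBall_zero_iff] at hτ
      rw [mem_ball_zero_iff]
      linarith
    have hK2 : ∀ᶠ z in 𝓝 z1, ∀ τ ∈ Metric.sphere (0 : ℂ) s, z + τ • v ∈ {z | δ z ≠ 0} := by
      refine (isCompact_sphere (0 : ℂ) s).eventually_forall_of_forall_eventually fun τ hτ => ?_
      have : Continuous fun p : E × ℂ => p.1 + p.2 • v := by fun_prop
      rw [mem_sphere_zero_iff_norm] at hτ
      refine this.continuousAt.eventually_mem (hopen.mem_nhds ((hball τ ?_).2 ?_))
      · rw [mem_ball_zero_iff]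
        linarith
      · rintro rfl
        simp at hτ
        linarith
    have hK3 : ∀ᶠ z in 𝓝 z1, δ (z + v) ≠ 0 := by
      have : Continuous fun z : E => z + v := by fun_prop
      exact this.continuousAt.eventually_mem (hopen.mem_nhds hv)
    refine ⟨fun x => Real.circleAverage (fun τ => h (x + τ • v)) 0 s, ?_⟩
    filter_upwards [hK1.eventually_nhds, hK2.eventually_nhds, hK3] with z h1 h2 h3
    refine ⟨differentiableAt_circleAverage (W := U ∩ {z | δ z ≠ 0}) (hU.inter hopen)
      (C := C) (fun x hx => (hd x hx.1 hx.2).differentiableWithinAt)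
      (fun x hx => hb x hx.1 hx.2) ?_, fun hz0 => ?_⟩
    · filter_upwards [h1, h2] with x hx1 hx2 θ
      have : circleMap 0 s θ ∈ Metric.sphere (0 : ℂ) s := circleMap_mem_sphere _ hspos.le _
      exact ⟨hx1 _ (Metric.sphere_subset_closedBall this), hx2 _ this⟩
    · have h1 := h1.self_of_nhds
      have h2 := h2.self_of_nhds
      have hline : Continuous fun τ : ℂ => z + τ • v := by fun_prop
      obtain ⟨F, hF, hFe⟩ := exists_extension_one_var (s := (fun τ : ℂ => z + τ • v) ⁻¹' U)
        (hU.preimage hline) (f := fun τ => h (z + τ • v)) (δ := fun τ => δ (z + τ • v))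
        (fun c _ => one z v h3 c)
        (fun τ hτ hτ0 => (hd _ hτ hτ0).comp τ (by fun_prop)) (C := C)
        (fun τ hτ hτ0 => hb _ hτ hτ0)
      have e1 : Real.circleAverage (fun τ => h (z + τ • v)) 0 s = Real.circleAverage F 0 s := by
        refine Real.circleAverage_congr_sphere fun τ hτ => ?_
        rw [abs_of_pos hspos] at hτ
        exact (hFe τ (h1 τ (Metric.sphere_subset_closedBall hτ)) (h2 τ hτ)).symm
      rw [e1, DiffContOnCl.circleAverage, hFe 0 (h1 0 (by simp [hspos.le])) (by simpa using hz0)]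
      · simp
      · rw [abs_of_pos hspos]
        refine (hF.mono fun τ hτ => ?_).diffContOnCl
        rw [closure_ball _ hspos.ne'] at hτ
        exact h1 τ hτ
  refine ⟨fun z => limUnder (𝓝[{x | δ x ≠ 0}] z) h, ?_, ?_⟩
  · intro z1 hz1
    obtain ⟨e, he⟩ := loc z1 hz1
    refine (he.self_of_nhds.1.congr_of_eventuallyEq ?_).differentiableWithinAt
    filter_upwards [he.eventually_nhds] with z hz
    have : (𝓝[{x | δ x ≠ 0}] z).NeBot := mem_closure_iff_nhdsWithin_neBot.1 (hdense z)
    refine Tendsto.limUnder_eq (((hz.self_of_nhds.1.continuousAt).tendsto.mono_left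
      nhdsWithin_le_nhds).congr' ?_)
    rw [EventuallyEq, eventually_nhdsWithin_iff]
    filter_upwards [hz] with x hx hx0 using hx.2 hx0
  · intro z hz hz0
    have : (𝓝[{x | δ x ≠ 0}] z).NeBot := mem_closure_iff_nhdsWithin_neBot.1 (hdense z)
    exact ((hd z hz hz0).continuousAt.tendsto.mono_left nhdsWithin_le_nhds).limUnder_eq

/-- The complement of the zero set of a nonzero entire function in a convex open set is
preconnected. -/
lemma isPreconnected_ne_zero {D : Set E} (hD : IsOpen D) (hc : Convex ℝ D) {δ : E → ℂ}
    (hδ : Differentiable ℂ δ) (h0 : ∃ x, δ x ≠ 0) : IsPreconnected (D ∩ {x | δ x ≠ 0}) := by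
  classical
  have hdense := dense_ne_zero hδ h0
  have hopen : IsOpen {z | δ z ≠ 0} := isOpen_ne_fun hδ.continuous continuous_const
  rw [isPreconnected_iff_subset_of_disjoint]
  intro u v hu hv huv hdisj
  by_contra! hcon
  obtain ⟨hcu, hcv⟩ := hcon
  obtain ⟨a, ⟨haD, ha0⟩, hau⟩ := Set.not_subset.1 hcu
  obtain ⟨b, ⟨hbD, hb0⟩, hbv⟩ := Set.not_subset.1 hcv
  have hbu : b ∈ u := (huv ⟨hbD, hb0⟩).resolve_right hbv
  have hav : a ∈ v := (huv ⟨haD, ha0⟩).resolve_left hau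
  have hnot : ∀ x ∈ D, δ x ≠ 0 → x ∈ v → x ∉ u := fun x hxD hx0 hxv hxu => by
    have : x ∈ D ∩ {x | δ x ≠ 0} ∩ (u ∩ v) := ⟨⟨hxD, hx0⟩, hxu, hxv⟩
    rwa [hdisj] at this
  have hloc1 : ∀ x ∈ D, δ x ≠ 0 → x ∈ u → ∀ᶠ y in 𝓝 x, u.indicator (1 : E → ℂ) y = 1 := by
    intro x _ _ hx
    filter_upwards [hu.mem_nhds hx] with y hy
    simp [hy]
  have hloc0 : ∀ x ∈ D, δ x ≠ 0 → x ∈ v → ∀ᶠ y in 𝓝 x, u.indicator (1 : E → ℂ) y = 0 := by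
    intro x hxD hx0 hx
    filter_upwards [hv.mem_nhds hx, hD.mem_nhds hxD, hopen.mem_nhds hx0] with y hy hyD hy0
    exact Set.indicator_of_notMem (hnot y hyD hy0 hy) _
  obtain ⟨H, hH, hHe⟩ := exists_extension hD hδ h0 (h := u.indicator 1) (C := 1)
    (fun x hxD hx0 => by
      rcases huv ⟨hxD, hx0⟩ with hx | hx
      · exact (differentiableAt_const (1 : ℂ)).congr_of_eventuallyEq (hloc1 x hxD hx0 hx)
      · exact (differentiableAt_const (0 : ℂ)).congr_of_eventuallyEq (hloc0 x hxD hx0 hx))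
    (fun x _ _ => by
      by_cases hx : x ∈ u <;> simp [hx])
  have hz := eq_zero_of_eventually_eq_zero hD hc hH haD (by
    filter_upwards [hloc0 a haD ha0 hav, hD.mem_nhds haD, hopen.mem_nhds ha0] with y hy hyD hy0
    rw [hHe y hyD hy0, hy]) b hbD
  rw [hHe b hbD hb0, (hloc1 b hbD hb0 hbu).self_of_nhds] at hz
  exact one_ne_zero hz

end Riemann

section Algebraicity

variable {d : ℕ}

/-- The algebra of holomorphic functions on `W`. -/
def holAlg (W : Set (Fin d → ℂ)) : Subalgebra ℂ (W → ℂ) where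
  carrier := {f | ∃ F : (Fin d → ℂ) → ℂ, DifferentiableOn ℂ F W ∧ ∀ x : W, f x = F x}
  mul_mem' := by
    rintro f g ⟨F, hF, hf⟩ ⟨G, hG, hg⟩
    exact ⟨fun x => F x * G x, hF.mul hG, fun x => by simp [hf, hg]⟩
  add_mem' := by
    rintro f g ⟨F, hF, hf⟩ ⟨G, hG, hg⟩
    exact ⟨fun x => F x + G x, hF.add hG, fun x => by simp [hf, hg]⟩
  algebraMap_mem' := fun c => ⟨fun _ => c, differentiableOn_const c, fun _ => rfl⟩

/-- A holomorphic function as an element of `holAlg`. -/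
def holAlg.mk {W : Set (Fin d → ℂ)} (F : (Fin d → ℂ) → ℂ) (hF : DifferentiableOn ℂ F W) :
    holAlg W := ⟨fun x => F x, F, hF, fun _ => rfl⟩

/-- Evaluation at a point. -/
def holAlg.ev {W : Set (Fin d → ℂ)} (x : W) : holAlg W →ₐ[ℂ] ℂ :=
  (Pi.evalAlgHom ℂ (fun _ : W => ℂ) x).comp (holAlg W).val

@[simp] lemma holAlg.ev_mk {W : Set (Fin d → ℂ)} (x : W) (F : (Fin d → ℂ) → ℂ)
    (hF : DifferentiableOn ℂ F W) : holAlg.ev x (holAlg.mk F hF) = F x := rfl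

lemma holAlg.ext_ev {W : Set (Fin d → ℂ)} {f g : holAlg W}
    (h : ∀ x, holAlg.ev x f = holAlg.ev x g) : f = g :=
  Subtype.ext (funext h)

noncomputable instance (W : Set (Fin d → ℂ)) : Algebra (MvPolynomial (Fin d) ℂ) (holAlg W) :=
  (MvPolynomial.aeval (R := ℂ) fun i =>
    holAlg.mk (W := W) (fun x => x i) (by fun_prop)).toRingHom.toAlgebra

@[simp] lemma holAlg.ev_algebraMap {W : Set (Fin d → ℂ)} (x : W) (p : MvPolynomial (Fin d) ℂ) :
    holAlg.ev x (algebraMap _ (holAlg W) p) = MvPolynomial.eval (x : Fin d → ℂ) p := by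
  have : ((holAlg.ev x).comp (MvPolynomial.aeval (R := ℂ) fun i =>
    holAlg.mk (W := W) (fun x => x i) (by fun_prop))) = MvPolynomial.aeval (x : Fin d → ℂ) := by
    ext i
    simp
  have := DFunLike.congr_fun this p
  rw [MvPolynomial.aeval_eq_eval] at this
  exact this

lemma holAlg.ev_aeval {W : Set (Fin d → ℂ)} (x : W) (f : holAlg W)
    (P : Polynomial (MvPolynomial (Fin d) ℂ)) :
    holAlg.ev x (Polynomial.aeval f P) =
      P.eval₂ (MvPolynomial.eval (x : Fin d → ℂ)) (holAlg.ev x f) := by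
  rw [Polynomial.aeval_def, ← RingHom.coe_coe, Polynomial.hom_eval₂]
  congr 1
  ext p <;> simp

lemma holAlg.isDomain {W : Set (Fin d → ℂ)} (hW : IsOpen W) (hc : Convex ℝ W)
    (hne : W.Nonempty) : IsDomain (holAlg W) := by
  have : Nontrivial (holAlg W) := by
    refine ⟨0, 1, fun h => ?_⟩
    have := congrArg (holAlg.ev ⟨_, hne.some_mem⟩) h
    simp at this
  have : NoZeroDivisors (holAlg W) := by
    refine ⟨fun {a b} hab => ?_⟩
    rw [or_iff_not_imp_left]
    intro ha
    obtain ⟨F, hF, hFa⟩ := a.2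
    obtain ⟨G, hG, hGb⟩ := b.2
    have : ∃ x : W, F x ≠ 0 := by
      by_contra! hcon
      exact ha (holAlg.ext_ev fun x => by simpa [holAlg.ev, hFa] using hcon x)
    obtain ⟨x, hx⟩ := this
    have hab' : ∀ y ∈ W, F y * G y = 0 := fun y hy => by
      rw [← hFa ⟨y, hy⟩, ← hGb ⟨y, hy⟩]
      exact congrArg (fun f : holAlg W => (f : W → ℂ) ⟨y, hy⟩) hab
    have hG0 := eq_zero_of_eventually_eq_zero hW hc hG x.2 (by
      filter_upwards [(hF.continuousOn.continuousAt (hW.mem_nhds x.2)).eventually_ne hx,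
        hW.mem_nhds x.2] with y hy hyW
      exact (mul_eq_zero.1 (hab' y hyW)).resolve_left hy)
    exact holAlg.ext_ev fun y => by
      have := hGb y
      simp only [holAlg.ev]
      simpa [hG0 y y.2] using this
  exact NoZeroDivisors.to_isDomain _

/-- `f` is holomorphic on `W` and satisfies there a nontrivial polynomial equation. -/
def AlgOn (W : Set (Fin d → ℂ)) (f : (Fin d → ℂ) → ℂ) : Prop :=
  DifferentiableOn ℂ f W ∧ ∃ P : Polynomial (MvPolynomial (Fin d) ℂ), P ≠ 0 ∧
    ∀ x ∈ W, P.eval₂ (MvPolynomial.eval x) (f x) = 0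

lemma algOn_iff {W : Set (Fin d → ℂ)} {f : (Fin d → ℂ) → ℂ} (hf : DifferentiableOn ℂ f W) :
    AlgOn W f ↔ IsAlgebraic (MvPolynomial (Fin d) ℂ) (holAlg.mk f hf) := by
  refine ⟨fun ⟨_, P, hP, h⟩ => ⟨P, hP, holAlg.ext_ev fun x => ?_⟩,
    fun ⟨P, hP, h⟩ => ⟨hf, P, hP, fun x hx => ?_⟩⟩
  · rw [holAlg.ev_aeval, map_zero]
    exact h x x.2
  · have := holAlg.ev_aeval ⟨x, hx⟩ (holAlg.mk f hf) P
    rw [h, map_zero] at this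
    exact this.symm

lemma AlgOn.congr {W : Set (Fin d → ℂ)} {f g : (Fin d → ℂ) → ℂ} (hf : AlgOn W f)
    (h : ∀ x ∈ W, g x = f x) : AlgOn W g := by
  obtain ⟨h1, P, hP, h2⟩ := hf
  exact ⟨h1.congr h, P, hP, fun x hx => by rw [h x hx, h2 x hx]⟩

lemma AlgOn.mono {W V : Set (Fin d → ℂ)} {f : (Fin d → ℂ) → ℂ} (hf : AlgOn W f)
    (h : V ⊆ W) : AlgOn V f := by
  obtain ⟨h1, P, hP, h2⟩ := hf
  exact ⟨h1.mono h, P, hP, fun x hx => h2 x (h hx)⟩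

lemma AlgOn.mul {W : Set (Fin d → ℂ)} {f g : (Fin d → ℂ) → ℂ} (hf : AlgOn W f)
    (hg : AlgOn W g) : AlgOn W fun x => f x * g x :=
  (algOn_iff (hf.1.mul hg.1)).2 (((algOn_iff hf.1).1 hf).mul ((algOn_iff hg.1).1 hg))

lemma AlgOn.add {W : Set (Fin d → ℂ)} {f g : (Fin d → ℂ) → ℂ} (hf : AlgOn W f)
    (hg : AlgOn W g) : AlgOn W fun x => f x + g x :=
  (algOn_iff (hf.1.add hg.1)).2 (((algOn_iff hf.1).1 hf).add ((algOn_iff hg.1).1 hg))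

lemma differentiable_mvEval (p : MvPolynomial (Fin d) ℂ) :
    Differentiable ℂ fun x : Fin d → ℂ => MvPolynomial.eval x p := by
  induction p using MvPolynomial.induction_on with
  | C a => simp
  | add p q hp hq =>
    simp only [map_add]
    exact hp.add hq
  | mul_X p i hp =>
    simp only [map_mul, MvPolynomial.eval_X]
    exact hp.mul (differentiable_apply (𝕜 := ℂ) i)

lemma algOn_eval (W : Set (Fin d → ℂ)) (p : MvPolynomial (Fin d) ℂ) :
    AlgOn W fun x => MvPolynomial.eval x p := by
  refine ⟨(differentiable_mvEval p).differentiableOn, Polynomial.X - Polynomial.C p,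
    Polynomial.X_sub_C_ne_zero p, fun x _ => by simp⟩

lemma algOn_const (W : Set (Fin d → ℂ)) (c : ℂ) : AlgOn W fun _ => c := by
  simpa using algOn_eval W (MvPolynomial.C c)

lemma AlgOn.prod {ι : Type*} {W : Set (Fin d → ℂ)} {f : ι → (Fin d → ℂ) → ℂ} {s : Finset ι}
    (hf : ∀ i ∈ s, AlgOn W (f i)) : AlgOn W fun x => ∏ i ∈ s, f i x := by
  classical
  induction s using Finset.induction_on with
  | empty => simpa using algOn_const W 1
  | insert a s ha ih =>
    simp only [Finset.prod_insert ha]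
    exact (hf a (by simp)).mul (ih fun i hi => hf i (by simp [hi]))

lemma AlgOn.sum {ι : Type*} {W : Set (Fin d → ℂ)} {f : ι → (Fin d → ℂ) → ℂ} {s : Finset ι}
    (hf : ∀ i ∈ s, AlgOn W (f i)) : AlgOn W fun x => ∑ i ∈ s, f i x := by
  classical
  induction s using Finset.induction_on with
  | empty => simpa using algOn_const W 0
  | insert a s ha ih =>
    simp only [Finset.sum_insert ha]
    exact (hf a (by simp)).add (ih fun i hi => hf i (by simp [hi]))

lemma AlgOn.aeval {n : ℕ} {W : Set (Fin d → ℂ)} {φ : (Fin d → ℂ) → Fin n → ℂ}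
    (hφ : ∀ i, AlgOn W fun x => φ x i) (p : MvPolynomial (Fin n) ℂ) :
    AlgOn W fun x => MvPolynomial.eval (φ x) p := by
  induction p using MvPolynomial.induction_on with
  | C a => simpa using algOn_const W a
  | add p q hp hq => simpa using hp.add hq
  | mul_X p i hp => simpa using hp.mul (hφ i)

lemma AlgOn.exists_coeff_zero_ne {W : Set (Fin d → ℂ)} (hW : IsOpen W) (hc : Convex ℝ W)
    {f : (Fin d → ℂ) → ℂ} (hf : AlgOn W f) (h0 : ∃ x ∈ W, f x ≠ 0) :
    ∃ P : Polynomial (MvPolynomial (Fin d) ℂ), P.coeff 0 ≠ 0 ∧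
      ∀ x ∈ W, P.eval₂ (MvPolynomial.eval x) (f x) = 0 := by
  obtain ⟨x, hx, hx0⟩ := h0
  have := holAlg.isDomain hW hc ⟨x, hx⟩
  obtain ⟨P, hP, h⟩ := ((algOn_iff hf.1).1 hf).exists_nonzero_coeff_and_aeval_eq_zero
    (mem_nonZeroDivisors_of_ne_zero fun h => hx0 (by
      simpa using congrArg (holAlg.ev ⟨x, hx⟩) h))
  refine ⟨P, hP, fun y hy => ?_⟩
  have := holAlg.ev_aeval ⟨y, hy⟩ (holAlg.mk f hf.1) P
  rw [h, map_zero] at this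
  exact this.symm

open Polynomial in
lemma exists_eq_C_X_pow_mul {A : Type*} [CommRing A] (R : A[X][X]) (hR : R ≠ 0) :
    ∃ (k : ℕ) (R₁ : A[X][X]), R = C (X ^ k) * R₁ ∧ R₁.map constantCoeff ≠ 0 := by
  obtain ⟨i, hi⟩ : ∃ i, R.coeff i ≠ 0 := by
    by_contra! h
    exact hR (Polynomial.ext (by simpa using h))
  induction hm : (R.coeff i).natDegree using Nat.strong_induction_on generalizing R with
  | _ m ih =>
    by_cases h : R.map constantCoeff = 0
    · have h1 : C X ∣ R := by
        rw [C_dvd_iff_dvd_coeff]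
        intro j
        rw [X_dvd_iff]
        have := congrArg (fun p => p.coeff j) h
        simpa using this
      obtain ⟨R', rfl⟩ := h1
      rw [coeff_C_mul] at hi hm
      have hi' : R'.coeff i ≠ 0 := right_ne_zero_of_mul hi
      have : Nontrivial A := by
        by_contra hA
        rw [not_nontrivial_iff_subsingleton] at hA
        exact hi' (Subsingleton.elim _ _)
      rw [natDegree_X_mul hi'] at hm
      obtain ⟨k, R₁, h1, h2⟩ := ih _ (by omega) R' (right_ne_zero_of_mul hR) hi' rfl
      refine ⟨k + 1, R₁, ?_, h2⟩
      rw [h1, pow_succ', C_mul, mul_assoc]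
    · exact ⟨0, R, by simp, h⟩

lemma isAlgebraic_of_isAlgebraic_algebraicClosure {R S : Type*} [CommRing R] [CommRing S]
    [Algebra R S] [IsDomain R] [IsDomain S] {x : S}
    (h : IsAlgebraic (Subalgebra.algebraicClosure R S) x) : IsAlgebraic R x := by
  have : Algebra.IsAlgebraic R (Subalgebra.algebraicClosure R S) :=
    ⟨fun a => (isAlgebraic_algebraMap_iff (A := S) Subtype.val_injective).1
      ((Subalgebra.mem_algebraicClosure R S).1 a.2)⟩
  exact h.restrictScalars R

open Polynomial in
lemma exists_polynomial_comp {A ι : Type*} [CommRing A] (ev : ι → A →+* ℂ) (cst : ℂ →+* A)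
    (hcst : ∀ x c, ev x (cst c) = c) {n : ℕ} (a : Fin n → A) {P : (MvPolynomial (Fin n) ℂ)[X]}
    (hP : P ≠ 0) {V : Set (Fin n → ℂ)} (hV : IsOpen V) {g : (Fin n → ℂ) → ℂ}
    (hg : ContinuousOn g V) (hPg : ∀ y ∈ V, P.eval₂ (MvPolynomial.eval y) (g y) = 0)
    (hm : ∀ x, (fun i => ev x (a i)) ∈ V) (b : ι) :
    ∃ Q : A[X], Q ≠ 0 ∧ ∀ x, Q.eval₂ (ev x) (g fun i => ev x (a i)) = 0 := by
  obtain ⟨j, hj⟩ : ∃ j, P.coeff j ≠ 0 := by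
    by_contra! h
    exact hP (Polynomial.ext (by simpa using h))
  obtain ⟨y, hy⟩ : ∃ y, MvPolynomial.eval y (P.coeff j) ≠ 0 := by
    by_contra! h
    exact hj (MvPolynomial.funext (by simpa using h))
  let v : Fin n → ℂ := fun i => y i - ev b (a i)
  let θ : MvPolynomial (Fin n) ℂ →+* A[X] := MvPolynomial.eval₂Hom (C.comp cst)
    fun i => C (a i) + X * C (cst (v i))
  have hθ : ∀ (x : ι) (τ : ℂ), (eval₂RingHom (ev x) τ).comp θ =
      MvPolynomial.eval ((fun i => ev x (a i)) + τ • v) := by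
    intro x τ
    ext i
    · simp [θ, hcst]
    · simp [θ, hcst]
      ring
  have hR : P.map θ ≠ 0 := by
    intro h
    have h1 := congrArg (fun p => (eval₂RingHom (ev b) 1) (p.coeff j)) h
    simp only [coeff_map, ← RingHom.comp_apply, hθ] at h1
    have h2 : (fun i => ev b (a i)) + (1 : ℂ) • v = y := by
      ext i
      simp [v]
    rw [h2] at h1
    exact hy (by simpa using h1)
  obtain ⟨k, R₁, hR₁, hne⟩ := exists_eq_C_X_pow_mul _ hR
  refine ⟨_, hne, fun x => ?_⟩
  have e1 : (R₁.map constantCoeff).eval₂ (ev x) (g fun i => ev x (a i)) =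
      R₁.eval₂ (eval₂RingHom (ev x) 0) (g fun i => ev x (a i)) := by
    rw [eval₂_map]
    congr 1
    ext p <;> simp
  rw [e1]
  have hcont : Tendsto (fun τ : ℂ => R₁.eval₂ (eval₂RingHom (ev x) τ)
      (g ((fun i => ev x (a i)) + τ • v))) (𝓝[≠] 0)
      (𝓝 (R₁.eval₂ (eval₂RingHom (ev x) 0) (g fun i => ev x (a i)))) := by
    have : ContinuousAt (fun τ : ℂ => R₁.eval₂ (eval₂RingHom (ev x) τ)
        (g ((fun i => ev x (a i)) + τ • v))) 0 := by
      simp only [eval₂_eq_sum_range, coe_eval₂RingHom]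
      refine tendsto_finsetSum _ fun i _ => ?_
      refine ContinuousAt.mul (by fun_prop) (ContinuousAt.pow ?_ _)
      refine ContinuousAt.comp (g := g) (f := fun τ : ℂ => (fun i => ev x (a i)) + τ • v) ?_
        (by fun_prop)
      simpa using (hg.continuousAt (hV.mem_nhds (hm x)))
    have h2 := this.tendsto
    simp only [zero_smul, add_zero] at h2
    exact h2.mono_left nhdsWithin_le_nhds
  refine tendsto_nhds_unique hcont (tendsto_const_nhds.congr' ?_)
  have hin : ∀ᶠ τ : ℂ in 𝓝 0, (fun i => ev x (a i)) + τ • v ∈ V := by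
    have : Continuous fun τ : ℂ => (fun i => ev x (a i)) + τ • v := by fun_prop
    exact this.continuousAt.eventually_mem (by simpa using hV.mem_nhds (hm x))
  filter_upwards [nhdsWithin_le_nhds hin, self_mem_nhdsWithin] with τ hτ hτ0
  have h1 := hPg _ hτ
  rw [← hθ x τ, ← eval₂_map, hR₁, eval₂_mul, eval₂_C] at h1
  simpa [show τ ≠ 0 from hτ0, eq_comm] using h1

/-- The composite of an algebraic holomorphic function with a holomorphic map with algebraic
components is algebraic. -/
lemma AlgOn.comp {n : ℕ} {W : Set (Fin d → ℂ)} (hW : IsOpen W) (hc : Convex ℝ W)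
    {φ : (Fin d → ℂ) → Fin n → ℂ} (hφ : ∀ i, AlgOn W fun x => φ x i)
    {V : Set (Fin n → ℂ)} (hV : IsOpen V) {g : (Fin n → ℂ) → ℂ} (hg : AlgOn V g)
    (hm : Set.MapsTo φ W V) : AlgOn W fun x => g (φ x) := by
  rcases W.eq_empty_or_nonempty with rfl | ⟨b, hb⟩
  · exact ⟨differentiableOn_empty, 1, one_ne_zero, by simp⟩
  have := holAlg.isDomain hW hc ⟨b, hb⟩
  obtain ⟨hgd, P, hP, hPg⟩ := hg
  have hφd : DifferentiableOn ℂ φ W := by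
    rw [differentiableOn_pi]
    exact fun i => (hφ i).1
  have hfd : DifferentiableOn ℂ (fun x => g (φ x)) W := hgd.comp hφd hm
  rw [algOn_iff hfd]
  refine isAlgebraic_of_isAlgebraic_algebraicClosure ?_
  obtain ⟨Q, hQ, h⟩ := exists_polynomial_comp
    (A := Subalgebra.algebraicClosure (MvPolynomial (Fin d) ℂ) (holAlg W))
    (fun x : W => (holAlg.ev x : holAlg W →+* ℂ).comp (algebraMap _ (holAlg W)))
    ((algebraMap (MvPolynomial (Fin d) ℂ) _).comp MvPolynomial.C)
    (fun x c => by
      change holAlg.ev x (algebraMap (MvPolynomial (Fin d) ℂ) (holAlg W) (MvPolynomial.C c)) = c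
      simp)
    (fun i => ⟨holAlg.mk _ (hφ i).1, by
      rw [Subalgebra.mem_algebraicClosure, ← algOn_iff]
      exact hφ i⟩) hP hV hgd.continuousOn hPg (fun x => hm x.2) ⟨b, hb⟩
  refine ⟨Q, hQ, holAlg.ext_ev fun x => ?_⟩
  rw [map_zero, ← h x, Polynomial.aeval_def, ← RingHom.coe_coe, Polynomial.hom_eval₂]
  rfl

/-- A polynomial relation holding near one point of a convex open set propagates. -/
lemma AlgOn.of_subset {W V : Set (Fin d → ℂ)} (hW : IsOpen W) (hc : Convex ℝ W) (hV : IsOpen V)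
    (hne : V.Nonempty) (hVW : V ⊆ W) {f : (Fin d → ℂ) → ℂ} (hf : DifferentiableOn ℂ f W)
    (h : AlgOn V f) : AlgOn W f := by
  obtain ⟨-, P, hP, h⟩ := h
  obtain ⟨b, hb⟩ := hne
  refine ⟨hf, P, hP, eq_zero_of_eventually_eq_zero hW hc ?_ (hVW hb) ?_⟩
  · simp only [Polynomial.eval₂_eq_sum_range]
    exact DifferentiableOn.fun_sum fun i _ =>
      ((differentiable_mvEval _).differentiableOn).mul (hf.pow _)
  · filter_upwards [hV.mem_nhds hb] with y hy using h y hy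

lemma nashFn_iff {U : Set (Fin d → ℂ)} (hU : IsOpen U) {f : (Fin d → ℂ) → ℂ} :
    NashFn d U f ↔ ∀ x ∈ U, ∃ r > 0, Metric.ball x r ⊆ U ∧ AlgOn (Metric.ball x r) f := by
  constructor
  · rintro ⟨hf, h⟩ x hx
    obtain ⟨V, hV, hxV, P, hP, hPf⟩ := h x hx
    obtain ⟨r, hr, hball⟩ := Metric.isOpen_iff.1 (hU.inter hV) x ⟨hx, hxV⟩
    exact ⟨r, hr, fun y hy => (hball hy).1, hf.mono fun y hy => (hball hy).1, P, hP,
      fun y hy => hPf y ⟨(hball hy).2, (hball hy).1⟩⟩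
  · intro h
    refine ⟨fun x hx => ?_, fun x hx => ?_⟩
    · obtain ⟨r, hr, hball, hf, -⟩ := h x hx
      exact (hf.differentiableAt (Metric.ball_mem_nhds x hr)).differentiableWithinAt
    · obtain ⟨r, hr, hball, hf, P, hP, h⟩ := h x hx
      exact ⟨_, Metric.isOpen_ball, Metric.mem_ball_self hr, P, hP, fun y hy => h y hy.1⟩

end Algebraicity

section ZeroSets

/-- A class of functions on open sets, stable under restriction and multiplication. -/
structure FnClass (E : Type) [TopologicalSpace E] where
  mem : Set E → (E → ℂ) → Prop
  mono : ∀ {U V : Set E} {f : E → ℂ}, IsOpen U → IsOpen V → V ⊆ U → mem U f → mem V f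
  mul : ∀ {U : Set E} {f g : E → ℂ}, IsOpen U → mem U f → mem U g → mem U fun x => f x * g x
  const : ∀ (U : Set E) (c : ℂ), mem U fun _ => c

/-- The class of holomorphic functions. -/
def holClass (E : Type) [NormedAddCommGroup E] [NormedSpace ℂ E] : FnClass E where
  mem U f := DifferentiableOn ℂ f U
  mono _ _ h hf := hf.mono h
  mul := fun _ hf hg => hf.mul hg
  const _ c := differentiableOn_const c

lemma NashFn.mono {n : ℕ} {U V : Set (Fin n → ℂ)} {f : (Fin n → ℂ) → ℂ} (h : V ⊆ U)
    (hf : NashFn n U f) : NashFn n V f := by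
  refine ⟨hf.1.mono h, fun x hx => ?_⟩
  obtain ⟨W, hW, hxW, P, hP, hPf⟩ := hf.2 x (h hx)
  exact ⟨W, hW, hxW, P, hP, fun y hy => hPf y ⟨hy.1, h hy.2⟩⟩

lemma NashFn.mul {n : ℕ} {U : Set (Fin n → ℂ)} (hU : IsOpen U) {f g : (Fin n → ℂ) → ℂ}
    (hf : NashFn n U f) (hg : NashFn n U g) : NashFn n U fun x => f x * g x := by
  rw [nashFn_iff hU] at *
  intro x hx
  obtain ⟨r, hr, h1, h2⟩ := hf x hx
  obtain ⟨s, hs, h3, h4⟩ := hg x hx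
  exact ⟨min r s, lt_min hr hs, (Metric.ball_subset_ball (min_le_left _ _)).trans h1,
    (h2.mono (Metric.ball_subset_ball (min_le_left _ _))).mul
    (h4.mono (Metric.ball_subset_ball (min_le_right _ _)))⟩

lemma AlgOn.nashFn {n : ℕ} {U : Set (Fin n → ℂ)} {f : (Fin n → ℂ) → ℂ}
    (h : AlgOn U f) : NashFn n U f := by
  obtain ⟨hf, P, hP, h⟩ := h
  exact ⟨hf, fun x hx => ⟨Set.univ, isOpen_univ, trivial, P, hP, fun y hy => h y hy.2⟩⟩

/-- The class of Nash functions. -/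
def nashClass (n : ℕ) : FnClass (Fin n → ℂ) where
  mem := NashFn n
  mono _ _ h hf := hf.mono h
  mul := fun hU hf hg => hf.mul hU hg
  const := fun U c => (algOn_const U c).nashFn

variable {E : Type} [TopologicalSpace E]

/-- Near `z`, `X` is the common zero set of finitely many functions of the class. -/
def LocZero (𝒞 : FnClass E) (X : Set E) (z : E) : Prop :=
  ∃ U : Set E, IsOpen U ∧ z ∈ U ∧ ∃ (N : ℕ) (g : Fin N → E → ℂ),
    (∀ i, 𝒞.mem U (g i)) ∧ X ∩ U = {x ∈ U | ∀ i, g i x = 0}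

variable {𝒞 : FnClass E} {X Y : Set E} {z : E}

lemma LocZero.of_finite {ι : Type*} [Finite ι] {U : Set E} (hU : IsOpen U) (hz : z ∈ U)
    (g : ι → E → ℂ) (hg : ∀ i, 𝒞.mem U (g i)) (h : ∀ x ∈ U, x ∈ X ↔ ∀ i, g i x = 0) :
    LocZero 𝒞 X z := by
  obtain ⟨N, ⟨e⟩⟩ := Finite.exists_equiv_fin ι
  refine ⟨U, hU, hz, N, fun i => g (e.symm i), fun i => hg _, ?_⟩
  ext x
  constructor
  · rintro ⟨hx, hxU⟩
    exact ⟨hxU, fun i => (h x hxU).1 hx _⟩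
  · rintro ⟨hxU, hx⟩
    exact ⟨(h x hxU).2 fun i => by simpa using hx (e i), hxU⟩

lemma LocZero.exists_subset (h : LocZero 𝒞 X z) {V : Set E} (hV : V ∈ 𝓝 z) :
    ∃ U ⊆ V, IsOpen U ∧ z ∈ U ∧ ∃ (N : ℕ) (g : Fin N → E → ℂ),
      (∀ i, 𝒞.mem U (g i)) ∧ ∀ x ∈ U, x ∈ X ↔ ∀ i, g i x = 0 := by
  obtain ⟨U, hU, hz, N, g, hg, hX⟩ := h
  obtain ⟨W, hWV, hW, hzW⟩ := mem_nhds_iff.1 hV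
  refine ⟨U ∩ W, fun x hx => hWV hx.2, hU.inter hW, ⟨hz, hzW⟩, N, g,
    fun i => 𝒞.mono hU (hU.inter hW) Set.inter_subset_left (hg i), fun x hx => ?_⟩
  have := Set.ext_iff.1 hX x
  simpa [hx.1] using this

lemma LocZero.congr (h : LocZero 𝒞 X z) (hXY : ∀ᶠ x in 𝓝 z, x ∈ Y ↔ x ∈ X) :
    LocZero 𝒞 Y z := by
  obtain ⟨U, hUV, hU, hz, N, g, hg, hX⟩ := h.exists_subset hXY
  exact LocZero.of_finite hU hz g hg fun x hx => (hUV hx).trans (hX x hx)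

lemma LocZero.empty (𝒞 : FnClass E) (z : E) : LocZero 𝒞 ∅ z :=
  ⟨Set.univ, isOpen_univ, trivial, 1, fun _ _ => 1, fun _ => 𝒞.const _ 1, by simp⟩

lemma LocZero.inter (hX : LocZero 𝒞 X z) (hY : LocZero 𝒞 Y z) : LocZero 𝒞 (X ∩ Y) z := by
  obtain ⟨U, -, hU, hzU, N, f, hf, hfX⟩ := hX.exists_subset univ_mem
  obtain ⟨V, hVU, hV, hzV, M, g, hg, hgY⟩ := hY.exists_subset (hU.mem_nhds hzU)
  refine LocZero.of_finite (ι := Fin N ⊕ Fin M) hV hzV (Sum.elim f g) ?_ fun x hx => ?_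
  · rintro (i | i)
    · exact 𝒞.mono hU hV hVU (hf i)
    · exact hg i
  · simp [hfX x (hVU hx), hgY x hx]

lemma LocZero.union (hX : LocZero 𝒞 X z) (hY : LocZero 𝒞 Y z) : LocZero 𝒞 (X ∪ Y) z := by
  obtain ⟨U, -, hU, hzU, N, f, hf, hfX⟩ := hX.exists_subset univ_mem
  obtain ⟨V, hVU, hV, hzV, M, g, hg, hgY⟩ := hY.exists_subset (hU.mem_nhds hzU)
  refine LocZero.of_finite (ι := Fin N × Fin M) hV hzV (fun i x => f i.1 x * g i.2 x)
    (fun i => 𝒞.mul hV (𝒞.mono hU hV hVU (hf i.1)) (hg i.2)) fun x hx => ?_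
  rw [Set.mem_union, hfX x (hVU hx), hgY x hx]
  constructor
  · rintro (h | h) i
    · simp [h]
    · simp [h]
  · intro h
    by_contra! hcon
    obtain ⟨⟨i, hi⟩, j, hj⟩ := hcon
    exact mul_ne_zero hi hj (h (i, j))

lemma LocZero.biUnion {ι : Type*} {s : Set ι} (hs : s.Finite) {P : ι → Set E}
    (h : ∀ i ∈ s, LocZero 𝒞 (P i) z) : LocZero 𝒞 (⋃ i ∈ s, P i) z := by
  induction s, hs using Set.Finite.induction_on with
  | empty => simpa using LocZero.empty 𝒞 z
  | insert _ _ ih =>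
    rw [Set.biUnion_insert]
    exact (h _ (by simp)).union (ih fun i hi => h i (by simp [hi]))

lemma LocZero.eventually_notMem {E : Type} [NormedAddCommGroup E] [NormedSpace ℂ E]
    {X : Set E} {z : E} (h : LocZero (holClass E) X z) (hz : z ∉ X) : ∀ᶠ x in 𝓝 z, x ∉ X := by
  obtain ⟨U, -, hU, hzU, N, f, hf, hfX⟩ := h.exists_subset univ_mem
  rw [hfX z hzU] at hz
  push Not at hz
  obtain ⟨i, hi⟩ := hz
  filter_upwards [((hf i).continuousOn.continuousAt (hU.mem_nhds hzU)).eventually_ne hi,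
    hU.mem_nhds hzU] with x hx hxU hxX
  exact hx ((hfX x hxU).1 hxX i)

lemma LocZero.of_nash {n : ℕ} {X : Set (Fin n → ℂ)} {z : Fin n → ℂ}
    (h : LocZero (nashClass n) X z) : LocZero (holClass _) X z := by
  obtain ⟨U, hU, hz, N, g, hg, hX⟩ := h
  exact ⟨U, hU, hz, N, g, fun i => (hg i).1, hX⟩

section Analytic

variable {E : Type} [NormedAddCommGroup E] [NormedSpace ℂ E] {Ω X Y : Set E}

lemma IsAnalyticIn.loc (hX : IsAnalyticIn Ω X) {z : E} (hz : z ∈ Ω) :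
    LocZero (holClass E) X z := hX.2 z hz

lemma IsAnalyticIn.of_loc (h : X ⊆ Ω) (hX : ∀ z ∈ Ω, LocZero (holClass E) X z) :
    IsAnalyticIn Ω X := ⟨h, hX⟩

lemma IsAnalyticIn.union (hX : IsAnalyticIn Ω X) (hY : IsAnalyticIn Ω Y) :
    IsAnalyticIn Ω (X ∪ Y) :=
  .of_loc (Set.union_subset hX.1 hY.1) fun _ hz => (hX.loc hz).union (hY.loc hz)

lemma IsAnalyticIn.inter (hX : IsAnalyticIn Ω X) (hY : IsAnalyticIn Ω Y) :
    IsAnalyticIn Ω (X ∩ Y) :=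
  .of_loc (fun _ hx => hX.1 hx.1) fun _ hz => (hX.loc hz).inter (hY.loc hz)

lemma IsAnalyticIn.biUnion {ι : Type*} {s : Set ι} (hs : s.Finite) {P : ι → Set E}
    (h : ∀ i ∈ s, IsAnalyticIn Ω (P i)) : IsAnalyticIn Ω (⋃ i ∈ s, P i) :=
  .of_loc (Set.iUnion₂_subset fun i hi => (h i hi).1)
    fun _ hz => LocZero.biUnion hs fun i hi => (h i hi).loc hz

lemma IsAnalyticIn.restrict (hX : IsAnalyticIn Ω X) {U : Set E} (hU : IsOpen U) (hUΩ : U ⊆ Ω) :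
    IsAnalyticIn U (X ∩ U) := by
  refine .of_loc Set.inter_subset_right fun z hz => (hX.loc (hUΩ hz)).congr ?_
  filter_upwards [hU.mem_nhds hz] with x hx
  simp [hx]

lemma IsAnalyticIn.eventually_notMem (hX : IsAnalyticIn Ω X) {z : E} (hz : z ∈ Ω) (hzX : z ∉ X) :
    ∀ᶠ x in 𝓝 z, x ∉ X := (hX.loc hz).eventually_notMem hzX

lemma isAnalyticIn_empty (Ω : Set E) : IsAnalyticIn Ω ∅ :=
  .of_loc (Set.empty_subset _) fun z _ => LocZero.empty _ z

end Analytic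

section Nash

variable {n : ℕ} {Ω X Y : Set (Fin n → ℂ)}

lemma IsNashIn.loc (hX : IsNashIn n Ω X) {z : Fin n → ℂ} (hz : z ∈ Ω) :
    LocZero (nashClass n) X z := hX.2 z hz

lemma IsNashIn.of_loc (h : X ⊆ Ω) (hX : ∀ z ∈ Ω, LocZero (nashClass n) X z) :
    IsNashIn n Ω X := ⟨h, hX⟩

lemma IsNashIn.isAnalyticIn (hX : IsNashIn n Ω X) : IsAnalyticIn Ω X :=
  .of_loc hX.1 fun _ hz => (hX.loc hz).of_nash

lemma IsNashIn.restrict (hX : IsNashIn n Ω X) {U : Set (Fin n → ℂ)} (hU : IsOpen U)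
    (hUΩ : U ⊆ Ω) : IsNashIn n U (X ∩ U) := by
  refine .of_loc Set.inter_subset_right fun z hz => (hX.loc (hUΩ hz)).congr ?_
  filter_upwards [hU.mem_nhds hz] with x hx
  simp [hx]

lemma IsAlgSet.isNashIn (hY : IsAlgSet n Y) (hΩ : IsOpen Ω) : IsNashIn n Ω (Y ∩ Ω) := by
  obtain ⟨q, ps, rfl⟩ := hY
  refine ⟨Set.inter_subset_right, fun z hz => ⟨Ω, hΩ, hz, q,
    fun i x => MvPolynomial.eval x (ps i), fun i => (algOn_eval _ _).nashFn, ?_⟩⟩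
  ext x
  simp [and_comm]

end Nash

end ZeroSets

section Algebra

open Polynomial in
/-- A monic polynomial over an integrally closed domain of characteristic zero divides a power of
a monic polynomial whose discriminant does not vanish identically. -/
lemma exists_separable_monic {A : Type*} [CommRing A] [IsDomain A] [IsIntegrallyClosed A]
    [CharZero A] {Q : A[X]} (hQ : Q.Monic) :
    ∃ (S F G : A[X]) (δ : A) (m : ℕ), S.Monic ∧ Q ∣ S ^ m ∧ δ ≠ 0 ∧
      F * S + G * derivative S = C δ := by
  classical
  let K := FractionRing A
  have : CharZero K := charZero_of_injective_algebraMap (IsFractionRing.injective A K)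
  have hinj : Function.Injective (algebraMap A K) := IsFractionRing.injective A K
  have hQK : Q.map (algebraMap A K) ≠ 0 := (hQ.map _).ne_zero
  set R := UniqueFactorizationMonoid.radical (Q.map (algebraMap A K)) with hR
  obtain ⟨S, hS⟩ := IsIntegrallyClosed.eq_map_mul_C_of_dvd K hQ
    (UniqueFactorizationMonoid.radical_dvd_self : R ∣ _)
  have hR0 : R ≠ 0 := UniqueFactorizationMonoid.radical_ne_zero
  have hlc : R.leadingCoeff ≠ 0 := leadingCoeff_ne_zero.2 hR0
  have hSm : S.Monic := by
    have h1 := congrArg leadingCoeff hS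
    rw [leadingCoeff_mul, leadingCoeff_C] at h1
    have h2 : (S.map (algebraMap A K)).leadingCoeff = 1 :=
      mul_right_cancel₀ hlc (by rw [h1, one_mul])
    rw [leadingCoeff_map_of_injective hinj] at h2
    exact hinj (by rw [h2, map_one])
  have hassoc : Associated (S.map (algebraMap A K)) R :=
    ⟨(isUnit_C.2 hlc.isUnit).unit, by simpa using hS⟩
  obtain ⟨m, hm⟩ := UniqueFactorizationMonoid.exists_dvd_radical_self_pow hQK
  have hdvd : Q ∣ S ^ m := by
    rw [← map_dvd_map (algebraMap A K) hinj hQ, Polynomial.map_pow]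
    exact hm.trans (hassoc.symm.pow_pow.dvd)
  have hsep : (S.map (algebraMap A K)).Separable := by
    rw [PerfectField.separable_iff_squarefree]
    exact hassoc.symm.squarefree_iff.1 UniqueFactorizationMonoid.squarefree_radical
  obtain ⟨a, b, hab⟩ := hsep
  obtain ⟨s, hs0, hs⟩ := IsLocalization.integerNormalization_spec (nonZeroDivisors A) a
  obtain ⟨t, ht0, ht⟩ := IsLocalization.integerNormalization_spec (nonZeroDivisors A) b
  refine ⟨S, C t * IsLocalization.integerNormalization (nonZeroDivisors A) a,
    C s * IsLocalization.integerNormalization (nonZeroDivisors A) b, s * t, m, hSm, hdvd,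
    mul_ne_zero (nonZeroDivisors.ne_zero hs0) (nonZeroDivisors.ne_zero ht0), ?_⟩
  refine map_injective _ hinj ?_
  simp only [Polynomial.map_add, Polynomial.map_mul, hs, ht, Polynomial.map_C, map_mul]
  rw [derivative_map] at hab
  rw [Algebra.smul_def, Algebra.smul_def]
  simp only [Polynomial.algebraMap_apply]
  linear_combination (C (algebraMap A K s) * C (algebraMap A K t)) * hab

/-- Noether normalization of the zero set of a proper ideal, with separable equations for the
coordinates. -/
lemma exists_noether_projection {n : ℕ} {I : Ideal (MvPolynomial (Fin n) ℂ)} (hI : I ≠ ⊤) :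
    ∃ (d : ℕ) (π : Fin d → MvPolynomial (Fin n) ℂ)
      (Q : Fin n → Polynomial (MvPolynomial (Fin d) ℂ)) (δ : MvPolynomial (Fin d) ℂ),
      (∀ p : MvPolynomial (Fin d) ℂ, p ≠ 0 → MvPolynomial.aeval π p ∉ I) ∧ δ ≠ 0 ∧
      (∀ i, (Q i).Monic) ∧
      (∀ z : Fin n → ℂ, (∀ f ∈ I, MvPolynomial.eval z f = 0) → ∀ i,
        (Q i).eval₂ (MvPolynomial.eval fun j => MvPolynomial.eval z (π j)) (z i) = 0) ∧
      ∀ (x : Fin d → ℂ) (t : ℂ) (i : Fin n), MvPolynomial.eval x δ ≠ 0 →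
        (Q i).eval₂ (MvPolynomial.eval x) t = 0 →
        (Polynomial.derivative (Q i)).eval₂ (MvPolynomial.eval x) t ≠ 0 := by
  obtain ⟨d, -, g, hg, hint⟩ := exists_integral_inj_algHom_of_quotient I hI
  choose π hπ using fun j => Ideal.Quotient.mk_surjective (g (MvPolynomial.X j))
  have hψ : ∀ p, Ideal.Quotient.mk I (MvPolynomial.aeval π p) = g p := by
    have : (Ideal.Quotient.mkₐ ℂ I).comp (MvPolynomial.aeval π) = g := by
      ext j
      simp [hπ]
    exact fun p => DFunLike.congr_fun this p
  choose Q₀ hQ₀m hQ₀ using fun i : Fin n => hint (Ideal.Quotient.mk I (MvPolynomial.X i))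
  choose S F G δ m hS hdvd hδ hFG using fun i => exists_separable_monic (hQ₀m i)
  refine ⟨d, π, S, ∏ i, δ i, fun p hp hpI => hp ?_, Finset.prod_ne_zero_iff.2 fun i _ => hδ i, hS,
    fun z hz i => ?_, fun x t i hx ht hcon => ?_⟩
  · rw [← Ideal.Quotient.eq_zero_iff_mem, hψ] at hpI
    exact hg (by rw [hpI, map_zero])
  · let e : (MvPolynomial (Fin n) ℂ ⧸ I) →+* ℂ := Ideal.Quotient.lift I (MvPolynomial.eval z) hz
    have he : e.comp (g : MvPolynomial (Fin d) ℂ →+* _) =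
        MvPolynomial.eval fun j => MvPolynomial.eval z (π j) := by
      ext j
      · change e (g (MvPolynomial.C _)) = _
        rw [← hψ]
        simp [e]
      · change e (g (MvPolynomial.X _)) = _
        rw [← hπ]
        simp [e]
    have h1 := congrArg e (hQ₀ i)
    rw [map_zero, Polynomial.hom_eval₂] at h1
    have h2 : e (Ideal.Quotient.mk I (MvPolynomial.X i)) = z i := by simp [e]
    rw [h2] at h1
    have h3 : (Q₀ i).eval₂ (MvPolynomial.eval fun j => MvPolynomial.eval z (π j)) (z i) = 0 := by
      rw [← he]
      exact h1
    have h4 := map_dvd (Polynomial.eval₂RingHom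
      (MvPolynomial.eval fun j => MvPolynomial.eval z (π j)) (z i)) (hdvd i)
    simp only [Polynomial.coe_eval₂RingHom, h3, zero_dvd_iff, map_pow] at h4
    exact eq_zero_of_pow_eq_zero h4
  · have h1 := congrArg (Polynomial.eval₂ (MvPolynomial.eval x) t) (hFG i)
    rw [Polynomial.eval₂_add, Polynomial.eval₂_mul, Polynomial.eval₂_mul, ht, hcon,
      Polynomial.eval₂_C] at h1
    rw [map_prod] at hx
    exact Finset.prod_ne_zero_iff.1 hx i (Finset.mem_univ i) (by simpa using h1.symm)

end Algebra

section Covering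

variable {d n : ℕ}

lemma contDiff_eval₂ {d : ℕ} (Q : Polynomial (MvPolynomial (Fin d) ℂ)) :
    ContDiff ℂ 1 fun p : (Fin d → ℂ) × ℂ => Q.eval₂ (MvPolynomial.eval p.1) p.2 := by
  simp only [Polynomial.eval₂_eq_sum_range]
  refine ContDiff.sum fun i _ => ContDiff.mul ?_ (contDiff_snd.pow i)
  have h : ContDiff ℂ 1 fun x : Fin d → ℂ => MvPolynomial.eval x (Q.coeff i) :=
    (AnalyticOnNhd.eval_mvPolynomial (Q.coeff i)).contDiff
  exact h.comp contDiff_fst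

lemma exists_local_root {d : ℕ} {Q : Polynomial (MvPolynomial (Fin d) ℂ)} {x₁ : Fin d → ℂ} {a : ℂ}
    (ha : Q.eval₂ (MvPolynomial.eval x₁) a = 0)
    (ha' : (Polynomial.derivative Q).eval₂ (MvPolynomial.eval x₁) a ≠ 0) :
    ∃ τ : (Fin d → ℂ) → ℂ, τ x₁ = a ∧ ∀ᶠ x in 𝓝 x₁, DifferentiableAt ℂ τ x ∧
      Q.eval₂ (MvPolynomial.eval x) (τ x) = 0 := by
  have hf : ContDiffAt ℂ 1 (fun p : (Fin d → ℂ) × ℂ => Q.eval₂ (MvPolynomial.eval p.1) p.2)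
    (x₁, a) := (contDiff_eval₂ Q).contDiffAt
  have hd : HasDerivAt (fun t => Q.eval₂ (MvPolynomial.eval x₁) t)
      ((Polynomial.derivative Q).eval₂ (MvPolynomial.eval x₁) a) a := by
    have := (Q.map (MvPolynomial.eval x₁)).hasDerivAt a
    simpa only [Polynomial.derivative_map, Polynomial.eval_map] using this
  have hinv : (fderiv ℂ (fun p : (Fin d → ℂ) × ℂ => Q.eval₂ (MvPolynomial.eval p.1) p.2) (x₁, a) ∘L
      .inr ℂ (Fin d → ℂ) ℂ).IsInvertible := by
    refine ⟨ContinuousLinearEquiv.unitsEquivAut ℂ (Units.mk0 _ ha'), ?_⟩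
    have h1 : HasFDerivAt (fun t : ℂ => ((x₁, t) : (Fin d → ℂ) × ℂ)) (.inr ℂ (Fin d → ℂ) ℂ) a :=
      hasFDerivAt_prodMk_right x₁ a
    have h2 := (hf.differentiableAt one_ne_zero).hasFDerivAt.comp a h1
    ext
    simpa using hd.unique h2.hasDerivAt
  refine ⟨hf.implicitFunction one_ne_zero hinv, hf.implicitFunction_apply_self one_ne_zero hinv, ?_⟩
  have h3 := (hf.contDiffAt_implicitFunction one_ne_zero hinv).eventually (by simp)
  filter_upwards [h3, hf.eventually_apply_implicitFunction one_ne_zero hinv] with x hx hx'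
  exact ⟨hx.differentiableAt one_ne_zero, hx'.trans ha⟩

lemma exists_local_roots {d : ℕ} {Q : Polynomial (MvPolynomial (Fin d) ℂ)} (hQ : Q.Monic)
    {x₁ : Fin d → ℂ} (h : ∀ a, Q.eval₂ (MvPolynomial.eval x₁) a = 0 →
      (Polynomial.derivative Q).eval₂ (MvPolynomial.eval x₁) a ≠ 0) :
    ∃ (R : Finset ℂ) (τ : ℂ → (Fin d → ℂ) → ℂ), (∀ a ∈ R, τ a x₁ = a) ∧
      (∀ a ∈ R, ∀ᶠ x in 𝓝 x₁, DifferentiableAt ℂ (τ a) x) ∧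
      (∀ᶠ x in 𝓝 x₁, (∀ t, Q.eval₂ (MvPolynomial.eval x) t = 0 ↔ ∃ a ∈ R, τ a x = t) ∧
        Set.InjOn (fun a => τ a x) R) := by
  classical
  have key : ∀ a, ∃ τ : (Fin d → ℂ) → ℂ, Q.eval₂ (MvPolynomial.eval x₁) a = 0 → τ x₁ = a ∧
      ∀ᶠ x in 𝓝 x₁, DifferentiableAt ℂ τ x ∧ Q.eval₂ (MvPolynomial.eval x) (τ x) = 0 := by
    intro a
    by_cases ha : Q.eval₂ (MvPolynomial.eval x₁) a = 0
    · obtain ⟨τ, hτ⟩ := exists_local_root ha (h a ha)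
      exact ⟨τ, fun _ => hτ⟩
    · exact ⟨0, fun h => absurd h ha⟩
  choose τ hτ using key
  have hmap : ∀ x, (Q.map (MvPolynomial.eval x)).Monic := fun x => hQ.map _
  have hroots : ∀ x t, t ∈ (Q.map (MvPolynomial.eval x)).roots.toFinset ↔
      Q.eval₂ (MvPolynomial.eval x) t = 0 := fun x t => by
    rw [Multiset.mem_toFinset, Polynomial.mem_roots (hmap x).ne_zero, Polynomial.IsRoot,
      Polynomial.eval_map]
  set R := (Q.map (MvPolynomial.eval x₁)).roots.toFinset with hR
  have hcard : R.card = Q.natDegree := by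
    have hs : (Q.map (MvPolynomial.eval x₁)).roots.Nodup := by
      refine Multiset.nodup_iff_count_le_one.2 fun a => ?_
      rw [Polynomial.count_roots]
      by_contra! hcon
      rw [Polynomial.one_lt_rootMultiplicity_iff_isRoot (hmap x₁).ne_zero,
        Polynomial.derivative_map,
        Polynomial.IsRoot, Polynomial.IsRoot, Polynomial.eval_map, Polynomial.eval_map] at hcon
      exact h a hcon.1 hcon.2
    rw [hR, Multiset.toFinset_card_of_nodup hs, ← IsAlgClosed.splits _ |>.natDegree_eq_card_roots, 
      hQ.natDegree_map]
  refine ⟨R, τ, fun a ha => (hτ a ((hroots _ _).1 ha)).1, fun a ha =>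
    (hτ a ((hroots _ _).1 ha)).2.mono fun x hx => hx.1, ?_⟩
  have h1 : ∀ᶠ x in 𝓝 x₁, ∀ a ∈ R, Q.eval₂ (MvPolynomial.eval x) (τ a x) = 0 :=
    (Finset.eventually_all R).2 fun a ha => (hτ a ((hroots _ _).1 ha)).2.mono fun x hx => hx.2
  have h2 : ∀ᶠ x in 𝓝 x₁, ∀ a ∈ R, ∀ b ∈ R, a ≠ b → τ a x ≠ τ b x := by
    refine (Finset.eventually_all R).2 fun a ha => (Finset.eventually_all R).2 fun b hb => ?_
    by_cases hab : a = b
    · simp [hab]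
    have ha' := hτ a ((hroots _ _).1 ha)
    have hb' := hτ b ((hroots _ _).1 hb)
    filter_upwards [(ha'.2.self_of_nhds.1.continuousAt.sub
      hb'.2.self_of_nhds.1.continuousAt).eventually_ne 
      (by rwa [Pi.sub_apply, ha'.1, hb'.1, sub_ne_zero])] with x hx _ using sub_ne_zero.1 hx
  filter_upwards [h1, h2] with x hx hx'
  have hinj : Set.InjOn (fun a => τ a x) R := fun a ha b hb hab => by
    by_contra hne
    exact hx' a ha b hb hne hab
  have heq : R.image (fun a => τ a x) = (Q.map (MvPolynomial.eval x)).roots.toFinset := by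
    refine Finset.eq_of_subset_of_card_le (fun t ht => ?_) ?_
    · obtain ⟨a, ha, rfl⟩ := Finset.mem_image.1 ht
      exact (hroots _ _).2 (hx a ha)
    · rw [Finset.card_image_of_injOn hinj, hcard, ← hQ.natDegree_map (MvPolynomial.eval x)]
      exact (Multiset.toFinset_card_le _).trans (Polynomial.card_roots' _)
  exact ⟨fun t => by rw [← hroots, ← heq, Finset.mem_image], hinj⟩

end Covering

section Covering

variable {d n : ℕ}

lemma AlgOn.continuousOn {W : Set (Fin d → ℂ)} {f : (Fin d → ℂ) → ℂ} (h : AlgOn W f) :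
    ContinuousOn f W := h.1.continuousOn

/-- A finite unramified covering of `D` whose local sections are algebraic functions. -/
def IsCover (D : Set (Fin d → ℂ)) (Z : Set ((Fin d → ℂ) × (Fin n → ℂ))) : Prop :=
  (∀ q ∈ Z, q.1 ∈ D) ∧ ∀ x₁ ∈ D, ∃ ρ > 0, Metric.ball x₁ ρ ⊆ D ∧
    ∃ (S : Finset (Fin n → ℂ)) (σ : (Fin n → ℂ) → (Fin d → ℂ) → Fin n → ℂ),
      (∀ s ∈ S, ∀ i, AlgOn (Metric.ball x₁ ρ) fun x => σ s x i) ∧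
      ∀ x ∈ Metric.ball x₁ ρ, Set.InjOn (fun s => σ s x) S ∧
        ∀ w, (x, w) ∈ Z ↔ ∃ s ∈ S, σ s x = w

variable {D : Set (Fin d → ℂ)} {Z : Set ((Fin d → ℂ) × (Fin n → ℂ))}

lemma IsCover.exists_chart (hZ : IsCover D Z) {q : (Fin d → ℂ) × (Fin n → ℂ)} (hq : q ∈ Z) :
    ∃ ρ > 0, Metric.ball q.1 ρ ⊆ D ∧ ∃ σ : (Fin d → ℂ) → Fin n → ℂ,
      (∀ i, AlgOn (Metric.ball q.1 ρ) fun x => σ x i) ∧ σ q.1 = q.2 ∧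
      (∀ x ∈ Metric.ball q.1 ρ, (x, σ x) ∈ Z) ∧ ∀ᶠ q' in 𝓝[Z] q, q'.2 = σ q'.1 := by
  obtain ⟨ρ, hρ, hρD, S, σ, hσ, h⟩ := hZ.2 q.1 (hZ.1 q hq)
  have hq1 : q.1 ∈ Metric.ball q.1 ρ := Metric.mem_ball_self hρ
  obtain ⟨s, hs, hsq⟩ := ((h q.1 hq1).2 q.2).1 hq
  refine ⟨ρ, hρ, hρD, σ s, hσ s hs, hsq, fun x hx => ((h x hx).2 _).2 ⟨s, hs, rfl⟩, ?_⟩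
  have hcont : ∀ t ∈ S, ContinuousAt (σ t) q.1 := fun t ht => continuousAt_pi.2 fun i =>
    (hσ t ht i).continuousOn.continuousAt (Metric.isOpen_ball.mem_nhds hq1)
  have h1 : ∀ᶠ q' in 𝓝 q, ∀ t ∈ S, t ≠ s → q'.2 - σ t q'.1 ≠ 0 := by
    refine (Finset.eventually_all S).2 fun t ht => ?_
    by_cases hts : t = s
    · simp [hts]
    have hc : ContinuousAt (fun q' : (Fin d → ℂ) × (Fin n → ℂ) => q'.2 - σ t q'.1) q :=
      continuousAt_snd.sub (ContinuousAt.comp (f := Prod.fst) (hcont t ht) continuousAt_fst)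
    filter_upwards [hc.eventually_ne (by
      rw [sub_ne_zero, ← hsq]
      exact fun h' => hts ((h q.1 hq1).1 hs ht h').symm)] with x hx _ using hx
  filter_upwards [nhdsWithin_le_nhds h1, self_mem_nhdsWithin,
    nhdsWithin_le_nhds (continuousAt_fst.preimage_mem_nhds
      (Metric.isOpen_ball.mem_nhds hq1))] with q' h1 h2 h3
  obtain ⟨t, ht, htq⟩ := ((h q'.1 h3).2 q'.2).1 h2
  by_cases hts : t = s
  · rw [← hts, htq]
  · exact absurd (sub_eq_zero.2 htq.symm) (h1 t ht hts)

/-- The graph of a local section lies in a single connected component. -/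
lemma mem_connectedComponentIn_of_section {B : Set (Fin d → ℂ)} (hB : IsPreconnected B)
    {σ : (Fin d → ℂ) → Fin n → ℂ} (hσ : ContinuousOn σ B) (h : ∀ x ∈ B, (x, σ x) ∈ Z)
    {q : (Fin d → ℂ) × (Fin n → ℂ)} {x y : Fin d → ℂ} (hx : x ∈ B) (hy : y ∈ B)
    (hxN : (x, σ x) ∈ connectedComponentIn Z q) : (y, σ y) ∈ connectedComponentIn Z q := by
  rw [connectedComponentIn_eq hxN]
  exact (hB.image (fun x => (x, σ x)) (continuousOn_id.prodMk hσ)).subset_connectedComponentIn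
    ⟨x, hx, rfl⟩ (by rintro _ ⟨y, hy, rfl⟩; exact h y hy) ⟨y, hy, rfl⟩

lemma IsCover.component (hZ : IsCover D Z) (q : (Fin d → ℂ) × (Fin n → ℂ)) :
    IsCover D (connectedComponentIn Z q) := by
  classical
  refine ⟨fun p hp => hZ.1 p (connectedComponentIn_subset Z q hp), fun x₁ hx₁ => ?_⟩
  obtain ⟨ρ, hρ, hρD, S, σ, hσ, h⟩ := hZ.2 x₁ hx₁
  refine ⟨ρ, hρ, hρD, S.filter fun s => (x₁, σ s x₁) ∈ connectedComponentIn Z q, σ,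
    fun s hs => hσ s (Finset.mem_filter.1 hs).1, fun x hx =>
    ⟨(h x hx).1.mono fun s hs => (Finset.mem_filter.1 hs).1, fun w => ?_⟩⟩
  have hc : ∀ s ∈ S, ContinuousOn (σ s) (Metric.ball x₁ ρ) := fun s hs =>
    continuousOn_pi.2 fun i => (hσ s hs i).continuousOn
  have hpc : IsPreconnected (Metric.ball x₁ ρ) := (convex_ball _ _).isPreconnected
  constructor
  · intro hw
    obtain ⟨s, hs, rfl⟩ := ((h x hx).2 w).1 (connectedComponentIn_subset Z q hw)
    exact ⟨s, Finset.mem_filter.2 ⟨hs, mem_connectedComponentIn_of_section hpc (hc s hs)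
      (fun y hy => ((h y hy).2 _).2 ⟨s, hs, rfl⟩) hx (Metric.mem_ball_self hρ) hw⟩, rfl⟩
  · rintro ⟨s, hs, rfl⟩
    obtain ⟨hs, hs'⟩ := Finset.mem_filter.1 hs
    exact mem_connectedComponentIn_of_section hpc (hc s hs)
      (fun y hy => ((h y hy).2 _).2 ⟨s, hs, rfl⟩) (Metric.mem_ball_self hρ) hx hs'

lemma IsCover.component_eventually (hZ : IsCover D Z) {q q₀ : (Fin d → ℂ) × (Fin n → ℂ)}
    (hq : q ∈ connectedComponentIn Z q₀) : ∀ᶠ q' in 𝓝[Z] q, q' ∈ connectedComponentIn Z q₀ := by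
  obtain ⟨ρ, hρ, -, σ, hσ, hσq, hσZ, hq'⟩ :=
    hZ.exists_chart (connectedComponentIn_subset Z q₀ hq)
  filter_upwards [hq', nhdsWithin_le_nhds (continuousAt_fst.preimage_mem_nhds
      (Metric.ball_mem_nhds q.1 hρ))] with p hp hp'
  have := mem_connectedComponentIn_of_section (convex_ball _ _).isPreconnected
    (continuousOn_pi.2 fun i => (hσ i).continuousOn) hσZ (Metric.mem_ball_self hρ) hp'
    (q := q₀) (by rwa [hσq])
  rwa [← hp] at this

/-- The cardinality of the fibers of a covering of a connected base is constant. -/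
lemma IsCover.exists_card (hZ : IsCover D Z) (hD : IsPreconnected D) :
    ∃ k : ℕ, ∀ x ∈ D, ∃ T : Finset (Fin n → ℂ), T.card = k ∧ ∀ w, w ∈ T ↔ (x, w) ∈ Z := by
  classical
  rcases D.eq_empty_or_nonempty with rfl | ⟨x₀, hx₀⟩
  · exact ⟨0, by simp⟩
  have key : ∀ x₁ ∈ D, ∀ᶠ x in 𝓝[D] x₁, {w | (x, w) ∈ Z}.ncard = {w | (x₁, w) ∈ Z}.ncard := by
    intro x₁ hx₁
    obtain ⟨ρ, hρ, hρD, S, σ, hσ, h⟩ := hZ.2 x₁ hx₁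
    have : ∀ x ∈ Metric.ball x₁ ρ, {w | (x, w) ∈ Z}.ncard = S.card := fun x hx => by
      have : {w | (x, w) ∈ Z} = (fun s => σ s x) '' S := by
        ext w
        simp [(h x hx).2 w]
      rw [this, (h x hx).1.ncard_image, Set.ncard_coe_finset]
    filter_upwards [nhdsWithin_le_nhds (Metric.ball_mem_nhds x₁ hρ)] with x hx
    rw [this x hx, this x₁ (Metric.mem_ball_self hρ)]
  refine ⟨{w | (x₀, w) ∈ Z}.ncard, fun x hx => ?_⟩
  obtain ⟨ρ, hρ, hρD, S, σ, hσ, h⟩ := hZ.2 x hx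
  have hT : ∀ w, w ∈ S.image (fun s => σ s x) ↔ (x, w) ∈ Z := fun w => by
    rw [(h x (Metric.mem_ball_self hρ)).2 w, Finset.mem_image]
  refine ⟨_, ?_, hT⟩
  have h1 : {w | (x, w) ∈ Z}.ncard = {w | (x₀, w) ∈ Z}.ncard := by
    refine hD.constant (f := fun x => {w | (x, w) ∈ Z}.ncard) (fun x hx => ?_) hx hx₀
    exact continuousWithinAt_const.congr_of_eventuallyEq (key x hx) rfl
  rw [← h1, ← Set.ncard_coe_finset]
  congr 1
  ext w
  exact hT w

end Covering

section Identity

variable {d n : ℕ} {D : Set (Fin d → ℂ)} {N K : Set ((Fin d → ℂ) × (Fin n → ℂ))}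

lemma IsCover.subset_of_eventually (hN : IsCover D N) (hc : IsPreconnected N)
    (hK : ∀ q ∈ N, LocZero (holClass _) K q) {q₀ : (Fin d → ℂ) × (Fin n → ℂ)} (hq₀ : q₀ ∈ N)
    (h : ∀ᶠ q in 𝓝 q₀, q ∈ N → q ∈ K) : N ⊆ K := by
  set u := {q | ∀ᶠ q' in 𝓝 q, q' ∈ N → q' ∈ K} with hu
  have huo : IsOpen u := isOpen_setOfPred_eventually_nhds
  have key : ∀ q ∈ N, q ∈ u ∨ ∀ᶠ q' in 𝓝 q, q' ∈ N → q' ∉ u := by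
    intro q hq
    obtain ⟨ρ, hρ, -, σ, hσ, hσq, hσN, hq'⟩ := hN.exists_chart hq
    obtain ⟨U, -, hU, hqU, m, g, hg, hgK⟩ := (hK q hq).exists_subset univ_mem
    have hσd : DifferentiableOn ℂ σ (Metric.ball q.1 ρ) := differentiableOn_pi.2 fun i => (hσ i).1
    have hs : DifferentiableOn ℂ (fun x => (x, σ x)) (Metric.ball q.1 ρ) :=
      differentiableOn_id.prodMk hσd
    have hs1 : ContinuousAt (fun x => (x, σ x)) q.1 :=
      hs.continuousOn.continuousAt (Metric.ball_mem_nhds _ hρ)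
    have h1 : (fun x => (x, σ x)) ⁻¹' U ∈ 𝓝 q.1 :=
      hs1.preimage_mem_nhds (hU.mem_nhds (by rw [hσq]; exact hqU))
    obtain ⟨ρ', hρ', hb⟩ := Metric.mem_nhds_iff.1 (inter_mem h1 (Metric.ball_mem_nhds q.1 hρ))
    have hf : ∀ j, DifferentiableOn ℂ (fun x => g j (x, σ x)) (Metric.ball q.1 ρ') := fun j =>
      (hg j).comp (hs.mono fun x hx => (hb hx).2) fun x hx => (hb hx).1
    have h2 : ∀ᶠ q' in 𝓝 q, q'.1 ∈ Metric.ball q.1 ρ' :=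
      continuousAt_fst.preimage_mem_nhds (Metric.ball_mem_nhds _ hρ')
    rw [eventually_nhdsWithin_iff] at hq'
    by_cases hcase : ∀ᶠ q' in 𝓝 q, q' ∈ N → q' ∉ u
    · exact .inr hcase
    left
    obtain ⟨p, hp, hpN, hpB, hpσ⟩ : ∃ p, p ∈ u ∧ p ∈ N ∧ p.1 ∈ Metric.ball q.1 ρ' ∧
        p.2 = σ p.1 := by
      by_contra! hcon
      refine hcase ?_
      filter_upwards [h2, hq'] with p h3 h4 h5 h6
      exact hcon p h6 h5 h3 (h4 h5)
    have hzero : ∀ j, ∀ x ∈ Metric.ball q.1 ρ', g j (x, σ x) = 0 := by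
      intro j
      refine eq_zero_of_eventually_eq_zero Metric.isOpen_ball (convex_ball _ _) (hf j) hpB ?_
      have h3 : ContinuousAt (fun x => (x, σ x)) p.1 :=
        hs.continuousOn.continuousAt (Metric.isOpen_ball.mem_nhds (hb hpB).2)
      have h4 : ∀ᶠ x in 𝓝 p.1, (x, σ x) ∈ N → (x, σ x) ∈ K :=
        h3.eventually (show ∀ᶠ y in 𝓝 (p.1, σ p.1), y ∈ N → y ∈ K by rw [← hpσ]; exact hp)
      filter_upwards [h4, Metric.isOpen_ball.mem_nhds hpB] with x hx hxB
      exact (hgK _ (hb hxB).1).1 (hx (hσN x (hb hxB).2)) j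
    filter_upwards [h2, hq'] with p h3 h4 hpN
    have : p = (p.1, σ p.1) := by rw [← h4 hpN]
    rw [this]
    exact (hgK _ (hb h3).1).2 fun j => hzero j _ h3
  have hNu : N ⊆ u := by
    intro q hq
    by_contra hqu
    obtain ⟨p, hpN, hpu, hpv⟩ := hc u {q | ∀ᶠ q' in 𝓝 q, q' ∈ N → q' ∉ u} huo
      isOpen_setOfPred_eventually_nhds key ⟨q₀, hq₀, h⟩ ⟨q, hq, (key q hq).resolve_left hqu⟩
    exact hpv.self_of_nhds hpN hpu
  exact fun q hq => (hNu hq).self_of_nhds hq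

lemma IsCover.subset_or_subset_closure (hN : IsCover D N) (hc : IsPreconnected N)
    (hK : ∀ q ∈ N, LocZero (holClass _) K q) : N ⊆ K ∨ N ⊆ closure (N \ K) := by
  by_cases h : ∃ q ∈ N, ∀ᶠ q' in 𝓝 q, q' ∈ N → q' ∈ K
  · obtain ⟨q, hq, h⟩ := h
    exact .inl (hN.subset_of_eventually hc hK hq h)
  · right
    push Not at h
    intro q hq
    rw [mem_closure_iff_frequently]
    exact (h q hq).mono fun p hp => hp

lemma differentiableOn_eval₂ {E : Type*} [NormedAddCommGroup E] [NormedSpace ℂ E]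
    (P : Polynomial (MvPolynomial (Fin d) ℂ)) {O : Set E} {φ : E → Fin d → ℂ} {f : E → ℂ}
    (hφ : DifferentiableOn ℂ φ O) (hf : DifferentiableOn ℂ f O) :
    DifferentiableOn ℂ (fun p => P.eval₂ (MvPolynomial.eval (φ p)) (f p)) O := by
  have h1 : Differentiable ℂ fun p : (Fin d → ℂ) × ℂ => P.eval₂ (MvPolynomial.eval p.1) p.2 :=
    (contDiff_eval₂ P).differentiable one_ne_zero
  intro x hx
  have h2 := DifferentiableAt.comp_differentiableWithinAt x (h1 (φ x, f x))
    ((hφ x hx).prodMk (hf x hx))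
  exact h2

/-- A point outside of the zero set of a function which is algebraic along the covering. -/
lemma IsCover.exists_polynomial (hN : IsCover D N) (hc : IsPreconnected N)
    {O : Set ((Fin d → ℂ) × (Fin n → ℂ))} (hO : IsOpen O) (hNO : N ⊆ O)
    {f : (Fin d → ℂ) × (Fin n → ℂ) → ℂ} (hf : DifferentiableOn ℂ f O)
    (halg : ∀ q ∈ N, ∀ (ρ : ℝ) (σ : (Fin d → ℂ) → Fin n → ℂ), 0 < ρ → σ q.1 = q.2 →
      (∀ i, AlgOn (Metric.ball q.1 ρ) fun x => σ x i) →
      ∃ ρ' > 0, AlgOn (Metric.ball q.1 ρ') fun x => f (x, σ x))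
    {q : (Fin d → ℂ) × (Fin n → ℂ)} (hq : q ∈ N) (hfq : f q ≠ 0) :
    ∃ p : MvPolynomial (Fin d) ℂ, p ≠ 0 ∧ ∀ q ∈ N, f q = 0 → MvPolynomial.eval q.1 p = 0 := by
  obtain ⟨ρ, hρ, -, σ, hσ, hσq, hσN, hq'⟩ := hN.exists_chart hq
  obtain ⟨ρ', hρ', hρf⟩ := halg q hq ρ σ hρ hσq hσ
  obtain ⟨P, hP0, hP⟩ := hρf.exists_coeff_zero_ne Metric.isOpen_ball (convex_ball _ _)
    ⟨q.1, Metric.mem_ball_self hρ', by rwa [hσq]⟩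
  refine ⟨P.coeff 0, hP0, ?_⟩
  have hsub : N ⊆ {p | P.eval₂ (MvPolynomial.eval p.1) (f p) = 0} := by
    refine hN.subset_of_eventually hc (fun p hp => ?_) hq ?_
    · refine LocZero.of_finite (ι := Unit) hO (hNO hp)
        (fun _ p => P.eval₂ (MvPolynomial.eval p.1) (f p)) (fun _ => ?_) fun p _ => by simp
      exact differentiableOn_eval₂ P differentiableOn_fst hf
    · rw [eventually_nhdsWithin_iff] at hq'
      filter_upwards [hq', continuousAt_fst.preimage_mem_nhds
        (Metric.ball_mem_nhds q.1 hρ')] with p h1 h2 hpN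
      have : p = (p.1, σ p.1) := by rw [← h1 hpN]
      rw [this]
      exact hP _ h2
  intro p hp hp0
  have := hsub hp
  rw [Set.mem_ofPred_eq, hp0] at this
  simpa [Polynomial.eval₂_at_zero] using this

end Identity

section Weierstrass

variable {d n : ℕ}

lemma isCover_of_monic {D : Set (Fin d → ℂ)} (hD : IsOpen D)
    {Q : Fin n → Polynomial (MvPolynomial (Fin d) ℂ)} (hQ : ∀ i, (Q i).Monic)
    (hsimple : ∀ x ∈ D, ∀ i t, (Q i).eval₂ (MvPolynomial.eval x) t = 0 →
      (Polynomial.derivative (Q i)).eval₂ (MvPolynomial.eval x) t ≠ 0)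
    {z₀ : Fin n → ℂ} {r : ℝ}
    (hr : ∀ x ∈ D, ∀ i t, (Q i).eval₂ (MvPolynomial.eval x) t = 0 → ‖t - z₀ i‖ ≠ r) :
    IsCover D {q | q.1 ∈ D ∧
      ∀ i, ‖q.2 i - z₀ i‖ < r ∧ (Q i).eval₂ (MvPolynomial.eval q.1) (q.2 i) = 0} := by
  classical
  refine ⟨fun q hq => hq.1, fun x₁ hx₁ => ?_⟩
  choose R τ hτ₁ hτd hτ using fun i => exists_local_roots (hQ i) (hsimple x₁ hx₁ i)
  have h1 : ∀ᶠ x in 𝓝 x₁, ∀ i, ∀ a ∈ R i, DifferentiableAt ℂ (τ i a) x :=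
    eventually_all.2 fun i => (Finset.eventually_all (R i)).2 fun a ha => hτd i a ha
  have h2 : ∀ᶠ x in 𝓝 x₁, ∀ i, ∀ a ∈ R i, (‖τ i a x - z₀ i‖ < r ↔ ‖a - z₀ i‖ < r) := by
    refine eventually_all.2 fun i => (Finset.eventually_all (R i)).2 fun a ha => ?_
    have hc : ContinuousAt (fun x => ‖τ i a x - z₀ i‖) x₁ :=
      ((hτd i a ha).self_of_nhds.continuousAt.sub continuousAt_const).norm
    have hne : ‖a - z₀ i‖ ≠ r := hr x₁ hx₁ i a
      (((hτ i).self_of_nhds.1 a).2 ⟨a, ha, hτ₁ i a ha⟩)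
    rcases hne.lt_or_gt with hlt | hgt
    · filter_upwards [hc.eventually_lt continuousAt_const (by simpa [hτ₁ i a ha] using hlt)]
        with x hx
      simp [hx, hlt]
    · filter_upwards [ContinuousAt.eventually_lt continuousAt_const hc
        (by simpa [hτ₁ i a ha] using hgt)] with x hx
      exact ⟨fun h => absurd hx h.not_gt, fun h => absurd hgt h.not_gt⟩
  obtain ⟨ρ, hρ, hb⟩ := Metric.eventually_nhds_iff_ball.1
    ((h1.and h2).and ((eventually_all.2 hτ).and (hD.eventually_mem hx₁)))
  refine ⟨ρ, hρ, fun x hx => (hb x hx).2.2,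
    Fintype.piFinset fun i => (R i).filter fun a => ‖a - z₀ i‖ < r,
    fun s x i => τ i (s i) x, fun s hs i => ?_, fun x hx => ⟨fun s hs t ht hst => ?_, fun w => ?_⟩⟩
  · simp only [Fintype.mem_piFinset, Finset.mem_filter] at hs
    refine ⟨fun x hx => ((hb x hx).1.1 i _ (hs i).1).differentiableWithinAt, Q i, (hQ i).ne_zero,
      fun x hx => ?_⟩
    exact (((hb x hx).2.1 i).1 _).2 ⟨s i, (hs i).1, rfl⟩
  · simp only [SetLike.mem_coe, Fintype.mem_piFinset, Finset.mem_filter] at hs ht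
    funext i
    exact ((hb x hx).2.1 i).2 (hs i).1 (ht i).1 (congrFun hst i)
  · obtain ⟨⟨-, hx2⟩, hx3, hx4⟩ := hb x hx
    constructor
    · rintro ⟨-, hw⟩
      choose s hs using fun i => ((hx3 i).1 (w i)).1 (hw i).2
      refine ⟨s, ?_, funext fun i => (hs i).2⟩
      simp only [Fintype.mem_piFinset, Finset.mem_filter]
      refine fun i => ⟨(hs i).1, (hx2 i _ (hs i).1).1 ?_⟩
      simpa [(hs i).2] using (hw i).1
    · rintro ⟨s, hs, rfl⟩
      simp only [Fintype.mem_piFinset, Finset.mem_filter] at hs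
      exact ⟨hx4, fun i => ⟨(hx2 i _ (hs i).1).2 (hs i).2,
        ((hx3 i).1 _).2 ⟨s i, (hs i).1, rfl⟩⟩⟩

/-- A finite set of points is determined by finitely many products of linear forms. -/
lemma exists_eq_of_forall_prod_eq_zero {k : ℕ} {v : Fin k → Fin n → ℂ}
    (h : ∀ r : Fin (k * n + 1), ∏ s, ∑ i : Fin n, ((r : ℕ) : ℂ) ^ (i : ℕ) * v s i = 0) :
    ∃ s, v s = 0 := by
  classical
  let p : Fin k → Polynomial ℂ := fun s =>
    ∑ i : Fin n, Polynomial.C (v s i) * Polynomial.X ^ (i : ℕ)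
  have hp : ∏ s, p s = 0 := by
    refine Polynomial.eq_zero_of_natDegree_lt_card_of_eval_eq_zero _
      (f := fun r : Fin (k * n + 1) => ((r : ℕ) : ℂ))
      (fun a b hab => Fin.ext (Nat.cast_injective hab)) (fun r => ?_) ?_
    · rw [← h r, Polynomial.eval_prod]
      refine Finset.prod_congr rfl fun s _ => ?_
      simp only [p, Polynomial.eval_finsetSum, Polynomial.eval_mul, Polynomial.eval_C,
        Polynomial.eval_pow, Polynomial.eval_X]
      exact Finset.sum_congr rfl fun i _ => mul_comm _ _
    · rw [Fintype.card_fin, Nat.lt_succ_iff]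
      refine (Polynomial.natDegree_prod_le _ _).trans ?_
      refine (Finset.sum_le_card_nsmul _ _ n fun s _ => ?_).trans (by simp)
      refine Polynomial.natDegree_sum_le_of_forall_le _ _ fun i _ => ?_
      exact (Polynomial.natDegree_C_mul_X_pow_le _ _).trans i.2.le
  obtain ⟨s, -, hs⟩ := Finset.prod_eq_zero_iff.1 hp
  refine ⟨s, funext fun i => ?_⟩
  have := congrArg (fun q => q.coeff (i : ℕ)) hs
  simpa [p, Polynomial.finsetSum_coeff, Polynomial.coeff_X_pow, Fin.val_inj] using this

end Weierstrass

section NashClosure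

variable {d n : ℕ}

lemma AlgOn.sub {W : Set (Fin d → ℂ)} {f g : (Fin d → ℂ) → ℂ} (hf : AlgOn W f)
    (hg : AlgOn W g) : AlgOn W fun x => f x - g x :=
  (hf.add ((algOn_const W (-1)).mul hg)).congr fun x _ => by ring

/-- The polynomial map with components `π`. -/
noncomputable def polyMap (π : Fin d → MvPolynomial (Fin n) ℂ) (z : Fin n → ℂ) : Fin d → ℂ :=
  fun j => MvPolynomial.eval z (π j)

variable {π : Fin d → MvPolynomial (Fin n) ℂ}

lemma differentiable_polyMap : Differentiable ℂ (polyMap π) :=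
  differentiable_pi.2 fun j => differentiable_mvEval (π j)

lemma eval_aeval (p : MvPolynomial (Fin d) ℂ) (z : Fin n → ℂ) :
    MvPolynomial.eval z (MvPolynomial.aeval π p) = MvPolynomial.eval (polyMap π z) p := by
  induction p using MvPolynomial.induction_on with
  | C a => simp
  | add p q hp hq => rw [map_add, map_add, map_add, hp, hq]
  | mul_X p i hp => rw [map_mul, map_mul, map_mul, hp]; simp [polyMap]

lemma exists_eval_ne_zero {p : MvPolynomial (Fin n) ℂ} (hp : p ≠ 0) :
    ∃ z, MvPolynomial.eval z p ≠ 0 := by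
  by_contra! h
  exact hp (MvPolynomial.funext fun z => by rw [h z, map_zero])

lemma dense_eval_ne_zero {p : MvPolynomial (Fin n) ℂ} (hp : p ≠ 0) :
    Dense {z | MvPolynomial.eval z p ≠ 0} :=
  dense_ne_zero (differentiable_mvEval p) (exists_eval_ne_zero hp)

lemma isNashIn_closure_of_isCover {D : Set (Fin d → ℂ)} {N : Set ((Fin d → ℂ) × (Fin n → ℂ))}
    (hN : IsCover D N) (hD : IsPreconnected D) {δ : MvPolynomial (Fin d) ℂ}
    (hδ : MvPolynomial.aeval π δ ≠ 0) {U : Set (Fin n → ℂ)} (hU : IsOpen U)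
    (hUD : ∀ z ∈ U, MvPolynomial.eval (polyMap π z) δ ≠ 0 → polyMap π z ∈ D)
    (hDδ : ∀ x ∈ D, MvPolynomial.eval x δ ≠ 0)
    (hNπ : ∀ q ∈ N, polyMap π q.2 = q.1) {C : ℝ} (hUC : ∀ z ∈ U, ‖z‖ ≤ C)
    (hNC : ∀ q ∈ N, ‖q.2‖ ≤ C) :
    IsNashIn n U (closure (Prod.snd '' N) ∩ U) := by
  classical
  obtain ⟨k, hk⟩ := hN.exists_card hD
  have hk' : ∀ x, ∃ T : Finset (Fin n → ℂ), x ∈ D → T.card = k ∧ ∀ w, w ∈ T ↔ (x, w) ∈ N := by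
    intro x
    by_cases hx : x ∈ D
    · obtain ⟨T, hT⟩ := hk x hx
      exact ⟨T, fun _ => hT⟩
    · exact ⟨∅, fun h => absurd h hx⟩
  choose T hT using hk'
  set δ' : (Fin n → ℂ) → ℂ := fun z => MvPolynomial.eval (polyMap π z) δ with hδ'
  have hδe : ∀ z, MvPolynomial.eval z (MvPolynomial.aeval π δ) = δ' z := eval_aeval δ
  have hδd : Differentiable ℂ δ' := by
    have := differentiable_mvEval (MvPolynomial.aeval π δ)
    exact (funext hδe : (fun z => MvPolynomial.eval z (MvPolynomial.aeval π δ)) = δ') ▸ this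
  have hδ0 : ∃ z, δ' z ≠ 0 := by
    obtain ⟨z, hz⟩ := exists_eval_ne_zero hδ
    exact ⟨z, by rwa [← hδe]⟩
  let G : ℕ → (Fin n → ℂ) → ℂ := fun r z =>
    ∏ w ∈ T (polyMap π z), ∑ i : Fin n, (r : ℂ) ^ (i : ℕ) * (z i - w i)
  have hGalg : ∀ z ∈ U, δ' z ≠ 0 → ∃ ρ > 0, Metric.ball z ρ ⊆ U ∧
      (∀ y ∈ Metric.ball z ρ, δ' y ≠ 0) ∧ ∀ r, AlgOn (Metric.ball z ρ) (G r) := by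
    intro z hz hδz
    obtain ⟨ρ, hρ, hρD, S, σ, hσ, h⟩ := hN.2 _ (hUD z hz hδz)
    have h1 : ∀ᶠ y in 𝓝 z, polyMap π y ∈ Metric.ball (polyMap π z) ρ :=
      differentiable_polyMap.continuous.continuousAt.preimage_mem_nhds (Metric.ball_mem_nhds _ hρ)
    obtain ⟨ρ', hρ', hb⟩ := Metric.eventually_nhds_iff_ball.1 (h1.and (hU.eventually_mem hz))
    refine ⟨ρ', hρ', fun y hy => (hb y hy).2, fun y hy => hDδ _ (hρD (hb y hy).1), fun r => ?_⟩
    have h2 : AlgOn (Metric.ball z ρ') fun y =>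
        ∏ s ∈ S, ∑ i : Fin n, (r : ℂ) ^ (i : ℕ) * (y i - σ s (polyMap π y) i) := by
      refine AlgOn.prod fun s hs => AlgOn.sum fun i _ => (algOn_const _ _).mul (AlgOn.sub ?_ ?_)
      · simpa using algOn_eval (Metric.ball z ρ') (MvPolynomial.X i)
      · exact AlgOn.comp Metric.isOpen_ball (convex_ball _ _) (fun j => algOn_eval _ (π j))
          Metric.isOpen_ball (hσ s hs i) fun y hy => (hb y hy).1
    refine h2.congr fun y hy => ?_
    have hy' := (hb y hy).1
    have : T (polyMap π y) = S.image fun s => σ s (polyMap π y) := by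
      ext w
      rw [(hT _ (hρD hy')).2, (h _ hy').2, Finset.mem_image]
    simp only [G]
    rw [this, Finset.prod_image (h _ hy').1]
  have hGb : ∀ r : ℕ, ∃ C', ∀ z ∈ U, δ' z ≠ 0 → ‖G r z‖ ≤ C' := by
    intro r
    refine ⟨(∑ i : Fin n, ‖(r : ℂ) ^ (i : ℕ)‖ * (C + C)) ^ k, fun z hz hδz => ?_⟩
    have hx := hT _ (hUD z hz hδz)
    simp only [G]
    rw [norm_prod, ← hx.1]
    rw [← Finset.prod_const]
    refine Finset.prod_le_prod (fun _ _ => norm_nonneg _) fun w hw => (norm_sum_le _ _).trans ?_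
    refine Finset.sum_le_sum fun i _ => ?_
    rw [norm_mul]
    refine mul_le_mul_of_nonneg_left ((norm_sub_le _ _).trans (add_le_add ?_ ?_)) (norm_nonneg _)
    · exact (norm_le_pi_norm z i).trans (hUC z hz)
    · exact (norm_le_pi_norm w i).trans (hNC _ ((hx.2 w).1 hw))
  have hGd : ∀ r : ℕ, ∀ z ∈ U, δ' z ≠ 0 → DifferentiableAt ℂ (G r) z := by
    intro r z hz hδz
    obtain ⟨ρ, hρ, -, -, h⟩ := hGalg z hz hδz
    exact (h r).1.differentiableAt (Metric.ball_mem_nhds _ hρ)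
  choose H hHd hHG using fun r => exists_extension hU hδd hδ0 (hGd r) (hGb r).choose_spec
  have hHc : ∀ r, ∀ z ∈ U, ContinuousAt (H r) z := fun r z hz =>
    (hHd r).continuousOn.continuousAt (hU.mem_nhds hz)
  have hdense : Dense {z | δ' z ≠ 0} := dense_ne_zero hδd hδ0
  have hHalg : ∀ r, NashFn n U (H r) := by
    intro r
    rw [nashFn_iff hU]
    intro z hz
    obtain ⟨ρ, hρ, hρU⟩ := Metric.isOpen_iff.1 hU z hz
    obtain ⟨y, hy, hyδ⟩ := hdense.inter_open_nonempty _ Metric.isOpen_ball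
      ⟨z, Metric.mem_ball_self hρ⟩
    obtain ⟨ρ', hρ', hρU', hne, hal⟩ := hGalg y (hρU hy) hyδ
    refine ⟨ρ, hρ, hρU, AlgOn.of_subset Metric.isOpen_ball (convex_ball _ _)
      (V := Metric.ball z ρ ∩ Metric.ball y ρ') (Metric.isOpen_ball.inter Metric.isOpen_ball)
      ⟨y, hy, Metric.mem_ball_self hρ'⟩ Set.inter_subset_left ((hHd r).mono hρU) ?_⟩
    exact ((hal r).mono Set.inter_subset_right).congr fun x hx =>
      hHG r x (hρU hx.1) (hne x hx.2)
  refine IsNashIn.of_loc Set.inter_subset_right fun z₀ hz₀ =>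
    LocZero.of_finite (ι := Fin (k * n + 1)) hU hz₀ (fun r => H r) (fun r => hHalg r) fun z hz => ?_
  constructor
  · rintro ⟨hzc, -⟩ r
    by_contra hne
    have hcont : ContinuousAt (H r) z := hHc r z hz
    obtain ⟨_, ⟨⟨x, w⟩, hq, rfl⟩, hw0, hw⟩ := ((mem_closure_iff_frequently.1 hzc).and_eventually
      ((hcont.eventually_ne hne).and (hU.eventually_mem hz))).exists
    refine hw0 ?_
    have hx : polyMap π w = x := hNπ (x, w) hq
    have hxD := hN.1 (x, w) hq
    have hδw : MvPolynomial.eval (polyMap π w) δ ≠ 0 := hx.symm ▸ hDδ x hxD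
    rw [hHG r w hw hδw]
    refine Finset.prod_eq_zero (i := w) ?_ (by simp)
    rw [hx]
    exact ((hT _ hxD).2 w).2 hq
  · intro h
    refine ⟨?_, hz⟩
    have hne : (𝓝[U ∩ {z | δ' z ≠ 0}] z).NeBot := by
      rw [← mem_closure_iff_nhdsWithin_neBot]
      exact hdense.open_subset_closure_inter hU hz
    let l : Ultrafilter (Fin n → ℂ) := Ultrafilter.of (𝓝[U ∩ {z | δ' z ≠ 0}] z)
    have hl : ↑l ≤ 𝓝[U ∩ {z | δ' z ≠ 0}] z := Ultrafilter.of_le _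
    have hlU : ∀ᶠ y in (l : Filter _), y ∈ U ∧ δ' y ≠ 0 := hl self_mem_nhdsWithin
    have hlz : Tendsto id (l : Filter _) (𝓝 z) := hl.trans nhdsWithin_le_nhds
    have henum : ∀ y, ∃ e : Fin k → Fin n → ℂ, y ∈ U ∧ δ' y ≠ 0 →
        (∀ s, (polyMap π y, e s) ∈ N) ∧
        ∀ F : (Fin n → ℂ) → ℂ, ∏ w ∈ T (polyMap π y), F w = ∏ s, F (e s) := by
      intro y
      by_cases hy : y ∈ U ∧ δ' y ≠ 0
      · obtain ⟨hc, hm⟩ := hT _ (hUD y hy.1 hy.2)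
        let e := (T (polyMap π y)).equivFinOfCardEq hc
        refine ⟨fun s => e.symm s, fun _ => ⟨fun s => (hm _).1 (e.symm s).2, fun F => ?_⟩⟩
        rw [← Finset.prod_coe_sort, ← e.symm.prod_comp]
      · exact ⟨0, fun h => absurd h hy⟩
    choose e he using henum
    have hcomp : IsCompact (Metric.closedBall (0 : Fin k → Fin n → ℂ) (max C 0)) :=
      isCompact_closedBall _ _
    obtain ⟨v, -, hv⟩ := hcomp.ultrafilter_le_nhds (l.map e) (by
      rw [le_principal_iff, Ultrafilter.coe_map, mem_map]
      filter_upwards [hlU] with y hy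
      rw [Set.mem_preimage, mem_closedBall_zero_iff, pi_norm_le_iff_of_nonneg (le_max_right _ _)]
      exact fun s => (hNC _ ((he y hy).1 s)).trans (le_max_left _ _))
    have hve : Tendsto e (l : Filter _) (𝓝 v) := hv
    obtain ⟨s, hs⟩ := exists_eq_of_forall_prod_eq_zero (k := k) (n := n) (v := fun s => z - v s) (by
      intro r
      have h1 : Tendsto (H r) (l : Filter _) (𝓝 (H r z)) :=
        (hHc r z hz).tendsto.comp hlz
      have h2 : Tendsto (fun y => ∏ s, ∑ i : Fin n, ((r : ℕ) : ℂ) ^ (i : ℕ) * (y - e y s) i)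
          (l : Filter _) (𝓝 (∏ s, ∑ i : Fin n, ((r : ℕ) : ℂ) ^ (i : ℕ) * (z - v s) i)) := by
        refine tendsto_finsetProd _ fun s _ => tendsto_finsetSum _ fun i _ =>
          tendsto_const_nhds.mul ?_
        have h3 : Tendsto (fun y => y - e y s) (l : Filter _) (𝓝 (z - v s)) :=
          hlz.sub (tendsto_pi_nhds.1 hve s)
        exact tendsto_pi_nhds.1 h3 i
      have h3 : H r =ᶠ[(l : Filter _)]
          fun y => ∏ s, ∑ i : Fin n, ((r : ℕ) : ℂ) ^ (i : ℕ) * (y - e y s) i := by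
        filter_upwards [hlU] with y hy
        rw [hHG r y hy.1 hy.2]
        exact (he y hy).2 _
      rw [tendsto_nhds_unique (h2.congr' h3.symm) h1, h r])
    have hs' : z = v s := sub_eq_zero.1 hs
    rw [hs']
    refine mem_closure_of_tendsto (tendsto_pi_nhds.1 hve s) ?_
    filter_upwards [hlU] with y hy
    exact ⟨_, (he y hy).1 s, rfl⟩

end NashClosure

section Pieces

variable {d n : ℕ}

lemma IsCover.exists_mem_fiber {D : Set (Fin d → ℂ)} {N : Set ((Fin d → ℂ) × (Fin n → ℂ))}
    (hN : IsCover D N) (hD : IsPreconnected D) (hne : N.Nonempty) {x : Fin d → ℂ} (hx : x ∈ D) :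
    ∃ w, (x, w) ∈ N := by
  obtain ⟨k, hk⟩ := hN.exists_card hD
  obtain ⟨⟨y, v⟩, hq⟩ := hne
  obtain ⟨S, hS, hS'⟩ := hk y (hN.1 _ hq)
  obtain ⟨T, hT, hT'⟩ := hk x hx
  have hpos : 0 < T.card := by
    rw [hT, ← hS]
    exact Finset.card_pos.2 ⟨v, (hS' v).2 hq⟩
  obtain ⟨w, hw⟩ := Finset.card_pos.1 hpos
  exact ⟨w, (hT' w).1 hw⟩

lemma IsCover.finite_components {D : Set (Fin d → ℂ)} {Z : Set ((Fin d → ℂ) × (Fin n → ℂ))}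
    (hZ : IsCover D Z) (hD : IsPreconnected D) :
    {N | ∃ q ∈ Z, N = connectedComponentIn Z q}.Finite := by
  rcases D.eq_empty_or_nonempty with rfl | ⟨x, hx⟩
  · refine Set.Finite.subset Set.finite_empty ?_
    rintro _ ⟨q, hq, -⟩
    exact hZ.1 q hq
  obtain ⟨k, hk⟩ := hZ.exists_card hD
  obtain ⟨T, -, hT⟩ := hk x hx
  refine (T.finite_toSet.image fun w => connectedComponentIn Z (x, w)).subset ?_
  rintro _ ⟨q, hq, rfl⟩
  obtain ⟨w, hw⟩ := (hZ.component q).exists_mem_fiber hD ⟨q, mem_connectedComponentIn hq⟩ hx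
  exact ⟨w, (hT w).2 (connectedComponentIn_subset _ _ hw), (connectedComponentIn_eq hw).symm⟩

lemma LocZero.preimage_snd {X : Set (Fin n → ℂ)} {q : (Fin d → ℂ) × (Fin n → ℂ)}
    (h : LocZero (holClass _) X q.2) : LocZero (holClass _) (Prod.snd ⁻¹' X) q := by
  obtain ⟨U, -, hU, hz, m, g, hg, hX⟩ := h.exists_subset univ_mem
  refine LocZero.of_finite (hU.preimage continuous_snd) hz (fun i p => g i p.2) (fun i => ?_)
    fun p hp => hX p.2 hp
  exact DifferentiableOn.comp (t := U) (hg i) differentiableOn_snd fun p hp => hp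

/-- A connected covering not contained in the graph over `X` meets it only over a proper
algebraic subset. -/
lemma IsCover.exists_polynomial_of_not_subset {D : Set (Fin d → ℂ)}
    {N : Set ((Fin d → ℂ) × (Fin n → ℂ))} (hN : IsCover D N) (hc : IsPreconnected N)
    {U : Set (Fin n → ℂ)} (hU : IsOpen U) (hNU : ∀ q ∈ N, q.2 ∈ U) {m : ℕ}
    {g : Fin m → (Fin n → ℂ) → ℂ} (hg : ∀ i, NashFn n U (g i)) {X : Set (Fin n → ℂ)}
    (hX : ∀ x ∈ U, x ∈ X ↔ ∀ i, g i x = 0) (π : Fin d → MvPolynomial (Fin n) ℂ) :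
    ∃ p : MvPolynomial (Fin d) ℂ, p ≠ 0 ∧ ((∀ q ∈ N, polyMap π q.2 = q.1 ∧ q.2 ∈ X) ∨
      ∀ q ∈ N, polyMap π q.2 = q.1 → q.2 ∈ X → MvPolynomial.eval q.1 p = 0) := by
  by_cases hgood : ∀ q ∈ N, polyMap π q.2 = q.1 ∧ q.2 ∈ X
  · exact ⟨1, one_ne_zero, .inl hgood⟩
  push Not at hgood
  obtain ⟨q, hq, hqX⟩ := hgood
  have hO : IsOpen ((Prod.snd : (Fin d → ℂ) × (Fin n → ℂ) → _) ⁻¹' U) := hU.preimage continuous_snd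
  by_cases hπ : polyMap π q.2 = q.1
  · have := hqX hπ
    rw [hX _ (hNU q hq)] at this
    push Not at this
    obtain ⟨i, hi⟩ := this
    obtain ⟨p, hp, h⟩ := hN.exists_polynomial hc hO hNU (f := fun q => g i q.2)
      (DifferentiableOn.comp (t := U) (hg i).1 differentiableOn_snd fun p hp => hp)
      (fun q hq ρ σ hρ hσq hσ => by
        obtain ⟨s, hs, hsU, hal⟩ := (nashFn_iff hU).1 (hg i) q.2 (hNU q hq)
        have hcont : ContinuousAt σ q.1 := continuousAt_pi.2 fun i =>
          (hσ i).continuousOn.continuousAt (Metric.ball_mem_nhds _ hρ)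
        have h1 : σ ⁻¹' Metric.ball q.2 s ∈ 𝓝 q.1 :=
          hcont.preimage_mem_nhds (by rw [hσq]; exact Metric.ball_mem_nhds _ hs)
        obtain ⟨ρ', hρ', hb⟩ := Metric.mem_nhds_iff.1 (inter_mem h1 (Metric.ball_mem_nhds q.1 hρ))
        exact ⟨ρ', hρ', AlgOn.comp Metric.isOpen_ball (convex_ball _ _)
          (fun i => (hσ i).mono fun x hx => (hb hx).2) Metric.isOpen_ball hal
          fun x hx => (hb hx).1⟩) hq hi
    exact ⟨p, hp, .inr fun q hq _ hqX => h q hq ((hX _ (hNU q hq)).1 hqX i)⟩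
  · obtain ⟨j, hj⟩ := Function.ne_iff.1 hπ
    obtain ⟨p, hp, h⟩ := hN.exists_polynomial hc hO hNU
      (f := fun q => MvPolynomial.eval q.2 (π j) - q.1 j)
      (by
        have h1 : Differentiable ℂ fun q : (Fin d → ℂ) × (Fin n → ℂ) =>
            MvPolynomial.eval q.2 (π j) :=
          (differentiable_mvEval (π j)).comp differentiable_snd
        exact (h1.sub (by fun_prop)).differentiableOn)
      (fun q hq ρ σ hρ hσq hσ => ⟨ρ, hρ, (AlgOn.aeval hσ (π j)).sub
        (by simpa using algOn_eval (Metric.ball q.1 ρ) (MvPolynomial.X j))⟩) hq (sub_ne_zero.2 hj)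
    exact ⟨p, hp, .inr fun q hq hqπ _ => h q hq (sub_eq_zero.2 (congrFun hqπ j))⟩

end Pieces

section LocalPieces

variable {d n : ℕ}

/-- An irreducible Nash subset `P` of the open set `U`, contained in `X`, whose points interior
to `P` relative to `X` are dense, and which is somewhere an open part of an algebraic set
containing it. -/
structure IsPiece (X P U : Set (Fin n → ℂ)) : Prop where
  isOpen : IsOpen U
  nonempty : P.Nonempty
  subset : P ⊆ X
  isNashIn : IsNashIn n U P
  irred : ∀ A, IsAnalyticIn U A → P ⊆ A ∨ P ⊆ closure (P \ A)
  dense : P ⊆ closure {y ∈ P | ∀ᶠ y' in 𝓝 y, y' ∈ X → y' ∈ P}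
  alg : ∃ Y W, IsAlgSet n Y ∧ P ⊆ Y ∧ IsOpen W ∧ (Y ∩ W).Nonempty ∧ Y ∩ W ⊆ P

lemma IsAnalyticIn.closure_inter_subset {E : Type} [NormedAddCommGroup E] [NormedSpace ℂ E]
    {U A S : Set E} (hA : IsAnalyticIn U A) (h : S ⊆ A) : closure S ∩ U ⊆ A := by
  rintro x ⟨hx, hxU⟩
  by_contra hxA
  obtain ⟨y, hy, hyA⟩ := ((mem_closure_iff_frequently.1 hx).and_eventually
    (hA.eventually_notMem hxU hxA)).exists
  exact hyA (h hy)

lemma IsCover.irred_closure {D : Set (Fin d → ℂ)} {N : Set ((Fin d → ℂ) × (Fin n → ℂ))}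
    (hN : IsCover D N) (hc : IsPreconnected N) {U A : Set (Fin n → ℂ)}
    (hNU : ∀ q ∈ N, q.2 ∈ U) (hA : IsAnalyticIn U A) :
    closure (Prod.snd '' N) ∩ U ⊆ A ∨
      closure (Prod.snd '' N) ∩ U ⊆ closure ((closure (Prod.snd '' N) ∩ U) \ A) := by
  rcases hN.subset_or_subset_closure hc (K := Prod.snd ⁻¹' A)
    (fun q hq => (hA.loc (hNU q hq)).preimage_snd) with h | h
  · exact .inl (hA.closure_inter_subset (Set.image_subset_iff.2 h))
  · refine .inr (Set.inter_subset_left.trans (closure_minimal ?_ isClosed_closure))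
    rintro _ ⟨q, hq, rfl⟩
    refine map_mem_closure continuous_snd (h hq) fun q' hq' => ?_
    exact ⟨⟨subset_closure ⟨q', hq'.1, rfl⟩, hNU _ hq'.1⟩, hq'.2⟩

lemma isAlgSet_of_polynomial (π : Fin d → MvPolynomial (Fin n) ℂ)
    (Q : Fin n → Polynomial (MvPolynomial (Fin d) ℂ)) :
    IsAlgSet n {z | ∀ i, (Q i).eval₂ (MvPolynomial.eval (polyMap π z)) (z i) = 0} := by
  refine ⟨n, fun i => (Q i).eval₂ (MvPolynomial.aeval π).toRingHom (MvPolynomial.X i), ?_⟩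
  ext z
  refine forall_congr' fun i => ?_
  rw [Polynomial.hom_eval₂, MvPolynomial.eval_X]
  have : (MvPolynomial.eval z).comp
      (MvPolynomial.aeval π : _ →ₐ[ℂ] MvPolynomial (Fin n) ℂ).toRingHom
      = MvPolynomial.eval (polyMap π z) := RingHom.ext fun p => eval_aeval p z
  rw [this]

lemma exists_radii {Q : Fin n → Polynomial (MvPolynomial (Fin d) ℂ)} (hQ : ∀ i, (Q i).Monic)
    (z₀ : Fin n → ℂ) (x₀ : Fin d → ℂ) {ε : ℝ} (hε : 0 < ε) :
    ∃ r > 0, r < ε ∧ ∃ ρ > 0, ∀ x ∈ Metric.ball x₀ ρ, ∀ i t,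
      (Q i).eval₂ (MvPolynomial.eval x) t = 0 → ‖t - z₀ i‖ ≠ r := by
  have hfin : (⋃ i, (fun t => ‖t - z₀ i‖) ''
      {t | (Q i).eval₂ (MvPolynomial.eval x₀) t = 0}).Finite := by
    refine Set.finite_iUnion fun i => Set.Finite.image _ ?_
    have hne : (Q i).map (MvPolynomial.eval x₀) ≠ 0 := ((hQ i).map _).ne_zero
    refine ((Q i).map (MvPolynomial.eval x₀)).roots.toFinset.finite_toSet.subset fun t ht => ?_
    simpa [hne, Polynomial.eval_map] using ht
  obtain ⟨r, hr, hr'⟩ := ((Set.Ioo_infinite hε).sdiff hfin).nonempty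
  have hx₀ : ∀ i t, (Q i).eval₂ (MvPolynomial.eval x₀) t = 0 → ‖t - z₀ i‖ ≠ r :=
    fun i t ht h => hr' (Set.mem_iUnion.2 ⟨i, t, ht, h⟩)
  have : ∀ᶠ x in 𝓝 x₀, ∀ i, ∀ t ∈ Metric.sphere (z₀ i) r,
      (Q i).eval₂ (MvPolynomial.eval x) t ≠ 0 := by
    refine eventually_all.2 fun i =>
      (isCompact_sphere (z₀ i) r).eventually_forall_of_forall_eventually fun t ht => ?_
    refine (contDiff_eval₂ (Q i)).continuous.continuousAt.eventually_ne fun h => ?_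
    exact hx₀ i t h (by simpa [dist_eq_norm] using ht)
  obtain ⟨ρ, hρ, hb⟩ := Metric.eventually_nhds_iff_ball.1 this
  refine ⟨r, hr.1, hr.2, ρ, hρ, fun x hx i t ht h => hb x hx i t ?_ ht⟩
  simpa [dist_eq_norm] using h

end LocalPieces

section Step

variable {n : ℕ}

set_option maxHeartbeats 400000 in
lemma exists_pieces_step {I : Ideal (MvPolynomial (Fin n) ℂ)} (hI : I ≠ ⊤)
    {Ω X A : Set (Fin n → ℂ)} (hΩ : IsOpen Ω) {z₀ : Fin n → ℂ} (hz₀ : z₀ ∈ Ω)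
    (hX : IsNashIn n Ω X) (hA : IsAnalyticIn Ω A)
    (hXI : ∀ x ∈ X, x ∉ A → ∀ f ∈ I, MvPolynomial.eval x f = 0) :
    ∃ U ⊆ Ω, IsOpen U ∧ z₀ ∈ U ∧ ∃ F : Set (Set (Fin n → ℂ)), F.Finite ∧
      (∀ P ∈ F, IsPiece X P U) ∧ ∃ f ∉ I, ∀ x ∈ X, x ∈ U →
        x ∈ A ∨ (∃ P ∈ F, x ∈ P) ∨ MvPolynomial.eval x f = 0 := by
  classical
  obtain ⟨d, π, Q, δ, hπI, hδ, hQ, hQX, hQδ⟩ := exists_noether_projection hI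
  have hπ0 : ∀ p ≠ 0, MvPolynomial.aeval π p ≠ 0 := fun p hp h =>
    hπI p hp (h ▸ I.zero_mem)
  obtain ⟨U₀, hU₀Ω, hU₀, hzU₀, m, g, hg, hXg⟩ := (hX.loc hz₀).exists_subset (hΩ.mem_nhds hz₀)
  obtain ⟨ε, hε, hεU⟩ := Metric.isOpen_iff.1 hU₀ z₀ hzU₀
  obtain ⟨r, hr, hrε, ρ, hρ, hroot⟩ := exists_radii hQ z₀ (polyMap π z₀) hε
  have hrU : Metric.ball z₀ r ⊆ U₀ := (Metric.ball_subset_ball hrε.le).trans hεU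
  set B := Metric.ball (polyMap π z₀) ρ with hB
  set D : Set (Fin d → ℂ) := B ∩ {x | MvPolynomial.eval x δ ≠ 0} with hD
  have hDo : IsOpen D := Metric.isOpen_ball.inter
    (isOpen_ne_fun (differentiable_mvEval δ).continuous continuous_const)
  have hDc : IsPreconnected D := isPreconnected_ne_zero Metric.isOpen_ball (convex_ball _ _)
    (differentiable_mvEval δ) (exists_eval_ne_zero hδ)
  set U : Set (Fin n → ℂ) := Metric.ball z₀ r ∩ polyMap π ⁻¹' B with hU
  have hUo : IsOpen U := Metric.isOpen_ball.inter
    (Metric.isOpen_ball.preimage differentiable_polyMap.continuous)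
  have hzU : z₀ ∈ U := ⟨Metric.mem_ball_self hr, Metric.mem_ball_self hρ⟩
  have hUΩ : U ⊆ Ω := fun x hx => hU₀Ω (hrU hx.1)
  set Z : Set ((Fin d → ℂ) × (Fin n → ℂ)) := {q | q.1 ∈ D ∧
      ∀ i, ‖q.2 i - z₀ i‖ < r ∧ (Q i).eval₂ (MvPolynomial.eval q.1) (q.2 i) = 0} with hZd
  have hZ : IsCover D Z := isCover_of_monic hDo hQ (fun x hx i t => hQδ x t i hx.2)
    fun x hx => hroot x hx.1
  have hZball : ∀ q ∈ Z, q.2 ∈ Metric.ball z₀ r := fun q hq => by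
    rw [Metric.mem_ball, dist_eq_norm, pi_norm_lt_iff hr]
    exact fun i => (hq.2 i).1
  have hUZ : ∀ x ∈ U, MvPolynomial.eval (polyMap π x) δ ≠ 0 →
      (∀ i, (Q i).eval₂ (MvPolynomial.eval (polyMap π x)) (x i) = 0) → (polyMap π x, x) ∈ Z := by
    intro x hx hxδ hxQ
    refine ⟨⟨hx.2, hxδ⟩, fun i => ⟨?_, hxQ i⟩⟩
    have := hx.1
    rw [Metric.mem_ball, dist_eq_norm, pi_norm_lt_iff hr] at this
    exact this i
  set 𝒩 := {N | ∃ q ∈ Z, N = connectedComponentIn Z q} with h𝒩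
  have h𝒩f : 𝒩.Finite := hZ.finite_components hDc
  have hNZ : ∀ N ∈ 𝒩, N ⊆ Z := by
    rintro _ ⟨q, hq, rfl⟩
    exact connectedComponentIn_subset _ _
  have hNcov : ∀ N ∈ 𝒩, IsCover D N := by
    rintro _ ⟨q, hq, rfl⟩
    exact hZ.component q
  have hNc : ∀ N ∈ 𝒩, IsPreconnected N := by
    rintro _ ⟨q, hq, rfl⟩
    exact isPreconnected_connectedComponentIn
  have hNne : ∀ N ∈ 𝒩, N.Nonempty := by
    rintro _ ⟨q, hq, rfl⟩
    exact ⟨q, mem_connectedComponentIn hq⟩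
  have hNev : ∀ N ∈ 𝒩, ∀ q ∈ N, ∀ᶠ q' in 𝓝[Z] q, q' ∈ N := by
    rintro _ ⟨q₀, hq₀, rfl⟩ q hq
    exact hZ.component_eventually hq
  have hNeq : ∀ N ∈ 𝒩, ∀ N' ∈ 𝒩, ∀ q ∈ N, q ∈ N' → N = N' := by
    rintro _ ⟨q₀, hq₀, rfl⟩ _ ⟨q₁, hq₁, rfl⟩ q h h'
    rw [connectedComponentIn_eq h, connectedComponentIn_eq h']
  set good : Set ((Fin d → ℂ) × (Fin n → ℂ)) → Prop :=
    fun N => ∀ q ∈ N, polyMap π q.2 = q.1 ∧ q.2 ∈ X with hgood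
  have hp : ∀ N, ∃ p : MvPolynomial (Fin d) ℂ, N ∈ 𝒩 → p ≠ 0 ∧ (good N ∨
      ∀ q ∈ N, polyMap π q.2 = q.1 → q.2 ∈ X → MvPolynomial.eval q.1 p = 0) := by
    intro N
    by_cases hN : N ∈ 𝒩
    · obtain ⟨p, hp⟩ := (hNcov N hN).exists_polynomial_of_not_subset (hNc N hN) hU₀
        (fun q hq => hrU (hZball q (hNZ N hN hq))) hg hXg π
      exact ⟨p, fun _ => hp⟩
    · exact ⟨0, fun h => absurd h hN⟩
  choose p hp using hp
  set e := δ * ∏ N ∈ h𝒩f.toFinset, p N with he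
  have he0 : e ≠ 0 := mul_ne_zero hδ (Finset.prod_ne_zero_iff.2 fun N hN =>
    (hp N (h𝒩f.mem_toFinset.1 hN)).1)
  have heδ : ∀ x, MvPolynomial.eval x e ≠ 0 → MvPolynomial.eval x δ ≠ 0 := by
    intro x hx
    rw [he, map_mul] at hx
    exact left_ne_zero_of_mul hx
  have hep : ∀ x, MvPolynomial.eval x e ≠ 0 → ∀ N ∈ 𝒩, MvPolynomial.eval x (p N) ≠ 0 := by
    intro x hx N hN
    rw [he, map_mul, map_prod] at hx
    exact Finset.prod_ne_zero_iff.1 (right_ne_zero_of_mul hx) N (h𝒩f.mem_toFinset.2 hN)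
  set Pc : Set ((Fin d → ℂ) × (Fin n → ℂ)) → Set (Fin n → ℂ) :=
    fun N => closure (Prod.snd '' N) ∩ U with hPc
  have hgU : ∀ N ∈ 𝒩, good N → ∀ q ∈ N, q.2 ∈ U := by
    intro N hN hgN q hq
    refine ⟨hZball q (hNZ N hN hq), ?_⟩
    rw [Set.mem_preimage, (hgN q hq).1]
    exact (hNZ N hN hq).1.1
  have hNash : ∀ N ∈ 𝒩, good N → IsNashIn n U (Pc N) := by
    intro N hN hgN
    have hball : ∀ x ∈ Metric.ball z₀ r, ‖x‖ ≤ ‖z₀‖ + r := fun x hx => by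
      have h1 := norm_le_norm_add_norm_sub' x z₀
      have h2 := mem_ball_iff_norm.1 hx
      linarith
    exact isNashIn_closure_of_isCover (hNcov N hN) hDc (hπ0 δ hδ) hUo
      (fun z hz hzδ => ⟨hz.2, hzδ⟩) (fun x hx => hx.2) (fun q hq => (hgN q hq).1)
      (fun z hz => hball z hz.1) fun q hq => hball _ (hZball q (hNZ N hN hq))
  have hXU : IsAnalyticIn U (X ∩ U) := hX.isAnalyticIn.restrict hUo hUΩ
  have hAU : IsAnalyticIn U (A ∩ U) := hA.restrict hUo hUΩ
  have hcover : ∀ x ∈ X, x ∈ U → x ∉ A → MvPolynomial.eval (polyMap π x) e ≠ 0 →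
      ∃ N ∈ 𝒩, good N ∧ x ∈ Pc N := by
    intro x hxX hxU hxA hxe
    have hxZ := hUZ x hxU (heδ _ hxe) (hQX x (hXI x hxX hxA))
    have hN : connectedComponentIn Z (polyMap π x, x) ∈ 𝒩 := ⟨_, hxZ, rfl⟩
    have hx := mem_connectedComponentIn hxZ
    refine ⟨_, hN, ?_, subset_closure ⟨_, hx, rfl⟩, hxU⟩
    refine (hp _ hN).2.resolve_right fun h => ?_
    exact hep _ hxe _ hN (h (polyMap π x, x) hx rfl hxX)
  have hnear : ∀ N ∈ 𝒩, good N → ∀ q ∈ N, ∀ᶠ w in 𝓝 q.2, (polyMap π w, w) ∈ Z →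
      (polyMap π w, w) ∈ N := by
    intro N hN hgN q hq
    have hcont : ContinuousAt (fun w => (polyMap π w, w)) q.2 :=
      (differentiable_polyMap.continuous.prodMk continuous_id).continuousAt
    have hq' : (polyMap π q.2, q.2) = q := Prod.ext (hgN q hq).1 rfl
    have := eventually_nhdsWithin_iff.1 (hNev N hN q hq)
    rw [← hq'] at this
    exact hcont.eventually this
  refine ⟨U, hUΩ, hUo, hzU, Pc '' {N ∈ 𝒩 | good N ∧ ¬ Pc N ⊆ A}, (h𝒩f.subset
    (fun N hN => hN.1)).image _, ?_, MvPolynomial.aeval π e, hπI e he0, ?_⟩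
  swap
  · intro x hxX hxU
    by_cases hxA : x ∈ A
    · exact .inl hxA
    by_cases hxe : MvPolynomial.eval (polyMap π x) e = 0
    · exact .inr (.inr (by rw [eval_aeval, hxe]))
    obtain ⟨N, hN, hgN, hxN⟩ := hcover x hxX hxU hxA hxe
    exact .inr (.inl ⟨_, ⟨N, ⟨hN, hgN, fun h => hxA (h hxN)⟩, rfl⟩, hxN⟩)
  rintro _ ⟨N, ⟨hN, hgN, hNA⟩, rfl⟩
  have hDne : D.Nonempty := by
    obtain ⟨q, hq⟩ := hNne N hN
    exact ⟨q.1, (hNZ N hN hq).1⟩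
  obtain ⟨x, hxD, hxe⟩ := (dense_eval_ne_zero he0).inter_open_nonempty D hDo hDne
  obtain ⟨w, hw⟩ := (hNcov N hN).exists_mem_fiber hDc (hNne N hN) hxD
  have hwx : polyMap π w = x := (hgN (x, w) hw).1
  have hwU : w ∈ U := hgU N hN hgN (x, w) hw
  have hwP : w ∈ Pc N := ⟨subset_closure ⟨_, hw, rfl⟩, hwU⟩
  have hirr : ∀ A, IsAnalyticIn U A → Pc N ⊆ A ∨ Pc N ⊆ closure (Pc N \ A) := fun A hA =>
    (hNcov N hN).irred_closure (hNc N hN) (hgU N hN hgN) hA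
  refine ⟨hUo, ⟨w, hwP⟩, ?_, hNash N hN hgN, hirr, ?_, ?_⟩
  · refine (hXU.closure_inter_subset ?_).trans Set.inter_subset_left
    rintro _ ⟨q, hq, rfl⟩
    exact ⟨(hgN q hq).2, hgU N hN hgN q hq⟩
  · set S := {N' ∈ 𝒩 | good N' ∧ N' ≠ N} with hS
    have hSf : S.Finite := h𝒩f.subset fun N hN => hN.1
    have hzero : IsAnalyticIn U ({z | MvPolynomial.eval (polyMap π z) e = 0} ∩ U) := by
      refine IsNashIn.isAnalyticIn (IsAlgSet.isNashIn ⟨1, fun _ => MvPolynomial.aeval π e, ?_⟩ hUo)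
      ext z
      simp only [Set.mem_ofPred_eq, eval_aeval, forall_const]
    set T := (⋃ N' ∈ S, Pc N') ∪ ({z | MvPolynomial.eval (polyMap π z) e = 0} ∩ U) with hT
    have hTan : IsAnalyticIn U T := (IsAnalyticIn.biUnion hSf fun N' hN' =>
      (hNash N' hN'.1 hN'.2.1).isAnalyticIn).union hzero
    have hwT : w ∉ T := by
      rintro (h | h)
      · obtain ⟨N', hN', hwN'⟩ := Set.mem_iUnion₂.1 h
        obtain ⟨_, ⟨q, hq, rfl⟩, hqN⟩ := ((mem_closure_iff_frequently.1 hwN'.1).and_eventually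
          (hnear N hN hgN (x, w) hw)).exists
        have hq' : (polyMap π q.2, q.2) = q := Prod.ext (hN'.2.1 q hq).1 rfl
        rw [hq'] at hqN
        exact hN'.2.2 (hNeq N' hN'.1 N hN q hq (hqN (hNZ N' hN'.1 hq)))
      · refine hxe ?_
        rw [← hwx]
        exact h.1
    have hATan : IsAnalyticIn U (A ∩ U ∪ T) := hAU.union hTan
    have hsub : Pc N ⊆ closure (Pc N \ (A ∩ U ∪ T)) := by
      refine (hirr _ hATan).resolve_left fun h => hwT ?_
      have h1 := (hirr _ hAU).resolve_left fun h => hNA (h.trans Set.inter_subset_left)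
      refine hTan.closure_inter_subset (S := Pc N \ (A ∩ U)) ?_ ⟨h1 hwP, hwU⟩
      exact fun y hy => (h hy.1).resolve_left hy.2
    refine hsub.trans (closure_mono fun y hy => ⟨hy.1, ?_⟩)
    filter_upwards [hATan.eventually_notMem hy.1.2 hy.2, hUo.mem_nhds hy.1.2] with y' hy' hy'U hy'X
    obtain ⟨N', hN', hgN', hyN'⟩ := hcover y' hy'X hy'U (fun h => hy' (.inl ⟨h, hy'U⟩))
      (fun h => hy' (.inr (.inr ⟨h, hy'U⟩)))
    by_cases hNN : N' = N
    · exact hNN ▸ hyN'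
    · exact absurd (.inr (.inl (Set.mem_iUnion₂.2 ⟨N', ⟨hN', hgN', hNN⟩, hyN'⟩))) hy'
  · have hY := isAlgSet_of_polynomial π Q
    set Y := {z | ∀ i, (Q i).eval₂ (MvPolynomial.eval (polyMap π z)) (z i) = 0} with hYd
    have hNY : ∀ q ∈ N, q.2 ∈ Y := by
      intro q hq i
      have := ((hNZ N hN hq).2 i).2
      rwa [← (hgN q hq).1] at this
    have hYan := (hY.isNashIn hUo).isAnalyticIn
    have hδw : ∀ᶠ w' in 𝓝 w, MvPolynomial.eval (polyMap π w') δ ≠ 0 := by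
      refine ContinuousAt.eventually_ne
        ((differentiable_mvEval δ).comp differentiable_polyMap).continuous.continuousAt ?_
      rw [hwx]
      exact hxD.2
    obtain ⟨W, hW, hWo, hwW⟩ := mem_nhds_iff.1
      (((hnear N hN hgN (x, w) hw).and hδw).and (hUo.eventually_mem hwU))
    refine ⟨Y, W, hY, (hYan.closure_inter_subset ?_).trans Set.inter_subset_left, hWo,
      ⟨w, hNY (x, w) hw, hwW⟩, ?_⟩
    · rintro _ ⟨q, hq, rfl⟩
      exact ⟨hNY q hq, hgU N hN hgN q hq⟩
    · rintro y ⟨hyY, hyW⟩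
      obtain ⟨⟨h1, h2⟩, h3⟩ := hW hyW
      exact ⟨subset_closure ⟨_, h1 (hUZ y h3 h2 hyY), rfl⟩, h3⟩

end Step

section Local

variable {n : ℕ}

lemma IsPiece.of_inter {X P U V : Set (Fin n → ℂ)} (hU : IsOpen U) (hVU : V ⊆ U)
    (h : IsPiece (X ∩ U) P V) : IsPiece X P V where
  isOpen := h.isOpen
  nonempty := h.nonempty
  subset := h.subset.trans Set.inter_subset_left
  isNashIn := h.isNashIn
  irred := h.irred
  dense := h.dense.trans (closure_mono fun y hy => ⟨hy.1, by
    filter_upwards [hy.2, hU.mem_nhds (hVU (h.isNashIn.1 hy.1))] with y' hy' hyU hyX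
    exact hy' ⟨hyX, hyU⟩⟩)
  alg := h.alg

lemma exists_pieces_of_ideal (I : Ideal (MvPolynomial (Fin n) ℂ)) :
    ∀ {Ω X A : Set (Fin n → ℂ)} {z : Fin n → ℂ}, IsOpen Ω → z ∈ Ω → IsNashIn n Ω X →
      IsAnalyticIn Ω A → (∀ x ∈ X, x ∉ A → ∀ f ∈ I, MvPolynomial.eval x f = 0) →
      ∃ F : Set (Set (Fin n → ℂ) × Set (Fin n → ℂ)), F.Finite ∧
        (∀ p ∈ F, IsPiece X p.1 p.2 ∧ z ∈ p.2 ∧ p.2 ⊆ Ω) ∧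
        ∀ᶠ x in 𝓝 z, x ∈ X → x ∈ A ∨ ∃ p ∈ F, x ∈ p.1 := by
  induction I using WellFoundedGT.induction with
  | ind I ih =>
    intro Ω X A z hΩ hz hX hA hXI
    by_cases hI : I = ⊤
    · refine ⟨∅, Set.finite_empty, by simp, .of_forall fun x hx => .inl ?_⟩
      by_contra hxA
      simpa using hXI x hx hxA 1 (hI ▸ Submodule.mem_top)
    obtain ⟨U, hUΩ, hU, hzU, F, hF, hFp, f, hfI, hcov⟩ := exists_pieces_step hI hΩ hz hX hA hXI
    obtain ⟨G, hG, hGp, hGcov⟩ := ih (I ⊔ Ideal.span {f})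
      (left_lt_sup.2 fun h => hfI (h (Ideal.mem_span_singleton_self f)))
      (Ω := U) (X := X ∩ U) (A := A ∩ U ∪ ⋃ P ∈ F, P) hU hzU (hX.restrict hU hUΩ)
      ((hA.restrict hU hUΩ).union (IsAnalyticIn.biUnion (P := id) hF fun P hP =>
        (hFp P hP).isNashIn.isAnalyticIn)) (by
        rintro x ⟨hxX, hxU⟩ hxA
        have hxA' : x ∉ A := fun h => hxA (.inl ⟨h, hxU⟩)
        have hle : I ⊔ Ideal.span {f} ≤ RingHom.ker (MvPolynomial.eval x) := by
          refine sup_le (fun g hg => hXI x hxX hxA' g hg) ?_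
          rw [Ideal.span_singleton_le_iff_mem]
          rcases hcov x hxX hxU with h | ⟨P, hP, hxP⟩ | h
          · exact absurd h hxA'
          · exact absurd (.inr (Set.mem_biUnion hP hxP)) hxA
          · exact h
        exact fun g hg => hle hg)
    refine ⟨(fun P => (P, U)) '' F ∪ G, (hF.image _).union hG, ?_, ?_⟩
    · rintro p (⟨P, hP, rfl⟩ | hp)
      · exact ⟨hFp P hP, hzU, hUΩ⟩
      · obtain ⟨h1, h2, h3⟩ := hGp p hp
        exact ⟨h1.of_inter hU h3, h2, h3.trans hUΩ⟩
    · filter_upwards [hGcov, hU.mem_nhds hzU] with x hx hxU hxX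
      rcases hx ⟨hxX, hxU⟩ with (h | h) | ⟨p, hp, hxp⟩
      · exact .inl h.1
      · obtain ⟨P, hP, hxP⟩ := Set.mem_iUnion₂.1 h
        exact .inr ⟨(P, U), .inl ⟨P, hP, rfl⟩, hxP⟩
      · exact .inr ⟨p, .inr hp, hxp⟩

lemma IsNashIn.exists_pieces {Ω X : Set (Fin n → ℂ)} (hX : IsNashIn n Ω X) (hΩ : IsOpen Ω)
    {z : Fin n → ℂ} (hz : z ∈ Ω) :
    ∃ F : Set (Set (Fin n → ℂ) × Set (Fin n → ℂ)), F.Finite ∧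
      (∀ p ∈ F, IsPiece X p.1 p.2 ∧ z ∈ p.2 ∧ p.2 ⊆ Ω) ∧
      ∀ᶠ x in 𝓝 z, x ∈ X → ∃ p ∈ F, x ∈ p.1 := by
  simpa using exists_pieces_of_ideal ⊥ hΩ hz hX (isAnalyticIn_empty Ω) fun x _ _ f hf => by
    simp [Ideal.mem_bot.1 hf]

end Local

section Global

variable {n : ℕ} {Ω X : Set (Fin n → ℂ)}

/-- The points of `P` near which `X` is contained in `P`. -/
def relInterior (X P : Set (Fin n → ℂ)) : Set (Fin n → ℂ) :=
  {y ∈ P | ∀ᶠ y' in 𝓝 y, y' ∈ X → y' ∈ P}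

/-- Two pieces of `X` whose interiors relative to `X` meet. -/
def AdjacentPieces (Ω X : Set (Fin n → ℂ)) (p q : Set (Fin n → ℂ) × Set (Fin n → ℂ)) : Prop :=
  (IsPiece X p.1 p.2 ∧ p.2 ⊆ Ω) ∧ (IsPiece X q.1 q.2 ∧ q.2 ⊆ Ω) ∧
    (relInterior X p.1 ∩ relInterior X q.1).Nonempty

/-- The pieces of `X` joined to `p` by a chain of adjacent pieces. -/
def pieceClass (Ω X : Set (Fin n → ℂ)) (p : Set (Fin n → ℂ) × Set (Fin n → ℂ)) :
    Set (Set (Fin n → ℂ) × Set (Fin n → ℂ)) :=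
  {q | Relation.ReflTransGen (AdjacentPieces Ω X) p q}

variable {p q : Set (Fin n → ℂ) × Set (Fin n → ℂ)}

lemma AdjacentPieces.symm (h : AdjacentPieces Ω X p q) : AdjacentPieces Ω X q p :=
  ⟨h.2.1, h.1, by rw [Set.inter_comm]; exact h.2.2⟩

lemma mem_pieceClass_symm (h : q ∈ pieceClass Ω X p) : p ∈ pieceClass Ω X q :=
  have : Std.Symm (AdjacentPieces Ω X) := ⟨fun _ _ h => h.symm⟩
  Relation.ReflTransGen.stdSymm.symm _ _ h

lemma isPiece_of_mem_pieceClass (hp : IsPiece X p.1 p.2 ∧ p.2 ⊆ Ω)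
    (h : q ∈ pieceClass Ω X p) : IsPiece X q.1 q.2 ∧ q.2 ⊆ Ω := by
  rcases Relation.ReflTransGen.cases_tail h with rfl | ⟨_, -, h⟩
  · exact hp
  · exact h.2.1

lemma IsPiece.relInterior_inter_nonempty {P Q U : Set (Fin n → ℂ)} (hQ : IsPiece X Q U)
    {y : Fin n → ℂ} (hyP : y ∈ relInterior X P) (hyQ : y ∈ Q) :
    (relInterior X P ∩ relInterior X Q).Nonempty := by
  obtain ⟨y', hy', hP⟩ := ((mem_closure_iff_frequently.1 (hQ.dense hyQ)).and_eventually
    (eventually_eventually_nhds.2 hyP.2)).exists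
  exact ⟨y', ⟨hP.self_of_nhds (hQ.subset hy'.1), hP⟩, hy'⟩

lemma IsPiece.subset_of_eventually {P U A : Set (Fin n → ℂ)} (hP : IsPiece X P U) (hU : U ⊆ Ω)
    (hA : IsAnalyticIn Ω A) {y : Fin n → ℂ} (hy : y ∈ P) (h : ∀ᶠ y' in 𝓝 y, y' ∈ P → y' ∈ A) :
    P ⊆ A := by
  refine ((hP.irred _ (hA.restrict hP.isOpen hU)).resolve_right fun hcl => ?_).trans
    Set.inter_subset_left
  obtain ⟨y', hy', hy'A⟩ := ((mem_closure_iff_frequently.1 (hcl hy)).and_eventually h).exists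
  exact hy'.2 ⟨hy'A hy'.1, hP.isNashIn.1 hy'.1⟩

lemma subset_of_mem_pieceClass {A : Set (Fin n → ℂ)} (hA : IsAnalyticIn Ω A) (hpA : p.1 ⊆ A)
    (h : q ∈ pieceClass Ω X p) : q.1 ⊆ A := by
  induction h with
  | refl => exact hpA
  | tail _ h ih =>
    obtain ⟨y, hy, hy'⟩ := h.2.2
    refine h.2.1.1.subset_of_eventually h.2.1.2 hA hy'.1 ?_
    filter_upwards [hy.2] with x hx hxq
    exact ih (hx (h.2.1.1.subset hxq))

lemma biUnion_pieceClass_subset {A W : Set (Fin n → ℂ)} (hp : IsPiece X p.1 p.2 ∧ p.2 ⊆ Ω)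
    (hA : IsAnalyticIn Ω A) (hW : IsOpen W)
    (hne : ((⋃ q ∈ pieceClass Ω X p, q.1) ∩ W).Nonempty)
    (h : (⋃ q ∈ pieceClass Ω X p, q.1) ∩ W ⊆ A) : (⋃ q ∈ pieceClass Ω X p, q.1) ⊆ A := by
  obtain ⟨x, hx, hxW⟩ := hne
  obtain ⟨q, hq, hxq⟩ := Set.mem_iUnion₂.1 hx
  have hq' := isPiece_of_mem_pieceClass hp hq
  have hqA : q.1 ⊆ A := hq'.1.subset_of_eventually hq'.2 hA hxq (by
    filter_upwards [hW.mem_nhds hxW] with y hyW hyq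
    exact h ⟨Set.mem_biUnion hq hyq, hyW⟩)
  exact Set.iUnion₂_subset fun q' hq' =>
    subset_of_mem_pieceClass hA hqA ((mem_pieceClass_symm hq).trans hq')

/-- The union of a set of pieces stable under adjacency is a Nash subset. -/
lemma IsNashIn.biUnion_pieces (hX : IsNashIn n Ω X) (hΩ : IsOpen Ω)
    {S : Set (Set (Fin n → ℂ) × Set (Fin n → ℂ))} (hS : ∀ p ∈ S, IsPiece X p.1 p.2 ∧ p.2 ⊆ Ω)
    (hadj : ∀ p ∈ S, ∀ q, AdjacentPieces Ω X p q → q ∈ S) : IsNashIn n Ω (⋃ p ∈ S, p.1) := by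
  refine .of_loc (Set.iUnion₂_subset fun p hp => (hS p hp).1.isNashIn.1.trans (hS p hp).2)
    fun z hz => ?_
  obtain ⟨F, hF, hFp, hcov⟩ := hX.exists_pieces hΩ hz
  have hFS : (F ∩ S).Finite := hF.subset Set.inter_subset_left
  have hloc : LocZero (nashClass n) (⋃ p ∈ F ∩ S, p.1) z := LocZero.biUnion hFS fun p hp =>
    (hFp p hp.1).1.isNashIn.loc (hFp p hp.1).2.1
  refine hloc.congr ?_
  have hnhds : ∀ᶠ x in 𝓝 z, ∀ p ∈ F, x ∈ p.2 := (Filter.eventually_all_finite hF).2 fun p hp =>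
    (hFp p hp).1.isOpen.eventually_mem (hFp p hp).2.1
  filter_upwards [hnhds, eventually_eventually_nhds.2 hcov] with x hx hxcov
  refine ⟨fun hxS => ?_, fun hxF => Set.biUnion_subset_biUnion_left Set.inter_subset_right hxF⟩
  by_contra hxF
  obtain ⟨p, hp, hxp⟩ := Set.mem_iUnion₂.1 hxS
  have hxloc : LocZero (holClass _) (⋃ p ∈ F ∩ S, p.1) x := LocZero.biUnion hFS fun p hp =>
    ((hFp p hp.1).1.isNashIn.loc (hx p hp.1)).of_nash
  obtain ⟨y, hy, hyF, hycov⟩ :=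
    ((mem_closure_iff_frequently.1 ((hS p hp).1.dense hxp)).and_eventually
    ((hxloc.eventually_notMem hxF).and hxcov)).exists
  obtain ⟨q, hq, hyq⟩ := hycov ((hS p hp).1.subset hy.1)
  obtain ⟨hqX, -, hqΩ⟩ := hFp q hq
  exact hyF (Set.mem_biUnion ⟨hq, hadj p hp q ⟨hS p hp, ⟨hqX, hqΩ⟩,
    hqX.relInterior_inter_nonempty hy hyq⟩⟩ hyq)

lemma IsNashIn.biUnion_pieceClass (hX : IsNashIn n Ω X) (hΩ : IsOpen Ω)
    (hp : IsPiece X p.1 p.2 ∧ p.2 ⊆ Ω) : IsNashIn n Ω (⋃ q ∈ pieceClass Ω X p, q.1) :=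
  hX.biUnion_pieces hΩ (fun _ hq => isPiece_of_mem_pieceClass hp hq) fun _ hq _ h => hq.tail h

lemma irredAnalyticIn_biUnion_pieceClass (hX : IsNashIn n Ω X) (hΩ : IsOpen Ω)
    (hp : IsPiece X p.1 p.2 ∧ p.2 ⊆ Ω) : IrredAnalyticIn Ω (⋃ q ∈ pieceClass Ω X p, q.1) := by
  have hpp : p.1 ⊆ ⋃ q ∈ pieceClass Ω X p, q.1 :=
    Set.subset_biUnion_of_mem (u := Prod.fst) (Relation.ReflTransGen.refl : p ∈ pieceClass Ω X p)
  refine ⟨(hX.biUnion_pieceClass hΩ hp).isAnalyticIn, hp.1.nonempty.mono hpp,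
    fun X₁ X₂ h₁ h₂ h => ?_⟩
  have key : ∀ {A}, IsAnalyticIn Ω A → p.1 ⊆ A → (⋃ q ∈ pieceClass Ω X p, q.1) ⊆ A :=
    fun hA hpA => Set.iUnion₂_subset fun q hq => subset_of_mem_pieceClass hA hpA hq
  by_cases hp₁ : p.1 ⊆ X₁
  · exact .inl ((key h₁ hp₁).antisymm (h ▸ Set.subset_union_left))
  obtain ⟨y, hy, hy₁⟩ := Set.not_subset.1 hp₁
  refine .inr ((key h₂ (hp.1.subset_of_eventually hp.2 h₂ hy ?_)).antisymm
    (h ▸ Set.subset_union_right))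
  filter_upwards [h₁.eventually_notMem (hp.2 (hp.1.isNashIn.1 hy)) hy₁] with y' hy' hyp
  exact (h ▸ hpp hyp : y' ∈ X₁ ∪ X₂).resolve_left hy'

section Irreducible

variable {E : Type} [NormedAddCommGroup E] [NormedSpace ℂ E] {Ω C A B : Set E}

lemma IrredAnalyticIn.subset_or_subset (hC : IrredAnalyticIn Ω C) (hA : IsAnalyticIn Ω A)
    (hB : IsAnalyticIn Ω B) (h : C ⊆ A ∪ B) : C ⊆ A ∨ C ⊆ B := by
  refine (hC.2.2 (C ∩ A) (C ∩ B) (hC.1.inter hA) (hC.1.inter hB) ?_).imp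
    (fun h => h.subset.trans Set.inter_subset_right) fun h => h.subset.trans Set.inter_subset_right
  rw [← Set.inter_union_distrib_left, Set.inter_eq_left.2 h]

lemma IrredAnalyticIn.exists_subset (hC : IrredAnalyticIn Ω C) {ι : Type*} {s : Set ι}
    (hs : s.Finite) {P : ι → Set E} (hP : ∀ i ∈ s, IsAnalyticIn Ω (P i))
    (h : C ⊆ ⋃ i ∈ s, P i) : ∃ i ∈ s, C ⊆ P i := by
  induction s, hs using Set.Finite.induction_on with
  | empty => exact absurd (hC.2.1.mono h) (by simp)
  | @insert i s _ hs ih =>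
    rw [Set.biUnion_insert] at h
    rcases hC.subset_or_subset (hP _ (by simp))
      (IsAnalyticIn.biUnion hs fun j hj => hP j (.inr hj)) h with h | h
    · exact ⟨i, by simp, h⟩
    · obtain ⟨j, hj, hCj⟩ := ih (fun j hj => hP j (.inr hj)) h
      exact ⟨j, .inr hj, hCj⟩

end Irreducible

lemma IsNashIn.exists_subset_biUnion_pieceClass (hX : IsNashIn n Ω X) (hΩ : IsOpen Ω)
    {C : Set (Fin n → ℂ)} (hC : IrredAnalyticIn Ω C) (hCX : C ⊆ X) :
    ∃ p : Set (Fin n → ℂ) × Set (Fin n → ℂ), (IsPiece X p.1 p.2 ∧ p.2 ⊆ Ω) ∧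
      C ⊆ ⋃ q ∈ pieceClass Ω X p, q.1 := by
  obtain ⟨z, hz⟩ := hC.2.1
  obtain ⟨F, hF, hFp, hcov⟩ := hX.exists_pieces hΩ (hC.1.1 hz)
  have hFp' : ∀ p ∈ F, IsPiece X p.1 p.2 ∧ p.2 ⊆ Ω := fun p hp => ⟨(hFp p hp).1, (hFp p hp).2.2⟩
  have hF' : IsAnalyticIn Ω (⋃ p ∈ F, ⋃ q ∈ pieceClass Ω X p, q.1) :=
    IsAnalyticIn.biUnion hF fun p hp => (hX.biUnion_pieceClass hΩ (hFp' p hp)).isAnalyticIn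
  set S : Set (Set (Fin n → ℂ) × Set (Fin n → ℂ)) :=
    {q | (IsPiece X q.1 q.2 ∧ q.2 ⊆ Ω) ∧ ∀ p ∈ F, q ∉ pieceClass Ω X p} with hS
  have hSn : IsNashIn n Ω (⋃ q ∈ S, q.1) := hX.biUnion_pieces hΩ (fun q hq => hq.1)
    fun q hq q' h => ⟨h.2.1, fun p hp hq' => hq.2 p hp (hq'.tail h.symm)⟩
  have hsub : C ⊆ (⋃ p ∈ F, ⋃ q ∈ pieceClass Ω X p, q.1) ∪ ⋃ q ∈ S, q.1 := by
    intro x hx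
    obtain ⟨G, -, hGp, hGcov⟩ := hX.exists_pieces hΩ (hC.1.1 hx)
    obtain ⟨q, hq, hxq⟩ := hGcov.self_of_nhds (hCX hx)
    by_cases h : ∃ p ∈ F, q ∈ pieceClass Ω X p
    · obtain ⟨p, hp, hqp⟩ := h
      exact .inl (Set.mem_biUnion hp (Set.mem_biUnion hqp hxq))
    · push Not at h
      exact .inr (Set.mem_biUnion ⟨⟨(hGp q hq).1, (hGp q hq).2.2⟩, h⟩ hxq)
  have hzS : z ∉ ⋃ q ∈ S, q.1 := by
    intro h
    obtain ⟨q, hq, hzq⟩ := Set.mem_iUnion₂.1 h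
    obtain ⟨y, hy, hycov⟩ := ((mem_closure_iff_frequently.1 (hq.1.1.dense hzq)).and_eventually
      hcov).exists
    obtain ⟨p, hp, hyp⟩ := hycov (hq.1.1.subset hy.1)
    have hadj : AdjacentPieces Ω X q p :=
      ⟨hq.1, hFp' p hp, (hFp p hp).1.relInterior_inter_nonempty hy hyp⟩
    exact hq.2 p hp (.single hadj.symm)
  obtain ⟨p, hp, hCp⟩ := hC.exists_subset hF
    (fun p hp => (hX.biUnion_pieceClass hΩ (hFp' p hp)).isAnalyticIn)
    ((hC.subset_or_subset hF' hSn.isAnalyticIn hsub).resolve_right fun h => hzS (h hz))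
  exact ⟨p, hFp' p hp, hCp⟩

end Global

theorem stmt_6 (n : ℕ) (Ω : Set (Fin n → ℂ)) (hΩ : IsOpen Ω)
    (X : Set (Fin n → ℂ)) (hX : IsNashIn n Ω X) :
    (∀ C : Set (Fin n → ℂ), IsIrredComp Ω X C → IsNashIn n Ω C ∧ IrredAnalyticIn Ω C) ∧
    (IrredAnalyticIn Ω X →
      ∃ Y : Set (Fin n → ℂ), IsAlgSet n Y ∧ IsIrredComp Ω (Y ∩ Ω) X) := by
  have hsubX : ∀ {X : Set (Fin n → ℂ)} {p}, (IsPiece X p.1 p.2 ∧ p.2 ⊆ Ω) →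
      (⋃ q ∈ pieceClass Ω X p, q.1) ⊆ X := fun hp =>
    Set.iUnion₂_subset fun q hq => (isPiece_of_mem_pieceClass hp hq).1.subset
  refine ⟨fun C hC => ⟨?_, hC.1⟩, fun hXi => ?_⟩
  · obtain ⟨p, hp, hCp⟩ := hX.exists_subset_biUnion_pieceClass hΩ hC.1 hC.2.1
    rw [← hC.2.2 _ (irredAnalyticIn_biUnion_pieceClass hX hΩ hp) hCp (hsubX hp)]
    exact hX.biUnion_pieceClass hΩ hp
  · obtain ⟨p, hp, hXp⟩ := hX.exists_subset_biUnion_pieceClass hΩ hXi subset_rfl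
    obtain ⟨Y, W, hY, hpY, hW, hne, hYW⟩ := hp.1.alg
    have hYn := hY.isNashIn hΩ
    have hXY : X ⊆ Y ∩ Ω := hXp.trans <| Set.iUnion₂_subset fun q hq =>
      subset_of_mem_pieceClass hYn.isAnalyticIn
        (Set.subset_inter hpY (hp.1.isNashIn.1.trans hp.2)) hq
    refine ⟨Y, hY, hXi, hXY, fun C hC hXC hCY => ?_⟩
    obtain ⟨q, hq, hCq⟩ := hYn.exists_subset_biUnion_pieceClass hΩ hC hCY
    have hWX : Y ∩ W ⊆ X := hYW.trans hp.1.subset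
    refine (hCq.trans (biUnion_pieceClass_subset hq hX.isAnalyticIn hW ?_ ?_)).antisymm hXC
    · obtain ⟨y, hy⟩ := hne
      exact ⟨y, hCq (hXC (hWX hy)), hy.2⟩
    · exact fun y hy => hWX ⟨(hsubX hq hy.1).1, hy.2⟩
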